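/- Let a_c := (2(R/ρ − 1 + R Σ_{i=1}^∞ λ_{i+1} ρ^{i−1}))^{-s} and for a ∈ ℝ let E_*(a) := {x ∈ E : Θ_*^s(μ,x) ≥ a}. Then: (i) if a < a_c then dim_H E_*(a) > 0; (ii) if a = a_c then E_*(a) is uncountable; (iii) if a > a_c then E_*(a) is at most countable. -/

import Mathlib

open MeasureTheory Filter Set Topology ENNReal

namespace HomogeneousCantorDensity

noncomputable def R (N : ℕ) (ρ : ℝ) : ℝ := (1 - ρ) / ((N : ℝ) - 1)

noncomputable def f (N : ℕ) (ρ : ℝ) (i : ℕ) (x : ℝ) : ℝ := ρ * x + (i : ℝ) * R N ρ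

noncomputable def piMap (N : ℕ) (ρ : ℝ) (d : ℕ → ℕ) : ℝ :=
  R N ρ * ∑' i : ℕ, (d i : ℝ) * ρ ^ i

def cantorE (N : ℕ) (ρ : ℝ) : Set ℝ :=
  {x | ∃ d : ℕ → ℕ, (∀ i, d i < N) ∧ x = piMap N ρ d}

/-- `μ = ∑_{i=0}^{N-1} (1/N) μ ∘ f_i⁻¹`. -/
def IsSelfSimilar (N : ℕ) (ρ : ℝ) (μ : Measure ℝ) : Prop :=
  μ = ∑ i ∈ Finset.range N, (N : ℝ≥0∞)⁻¹ • μ.map (f N ρ i)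

/-- `T^n x` for `x = piMap N ρ d`. -/
noncomputable def Tn (N : ℕ) (ρ : ℝ) (d : ℕ → ℕ) (n : ℕ) : ℝ :=
  piMap N ρ (fun i => d (n + i))

/-- pointwise lower `s`-density of `μ` at `x`. -/
noncomputable def lowerDensity (μ : Measure ℝ) (s x : ℝ) : ℝ :=
  liminf (fun r : ℝ => (μ (Ioo (x - r) (x + r))).toReal / (2 * r) ^ s) (𝓝[>] 0)

/-- pointwise upper `s`-density of `μ` at `x`. -/
noncomputable def upperDensity (μ : Measure ℝ) (s x : ℝ) : ℝ :=
  limsup (fun r : ℝ => (μ (Ioo (x - r) (x + r))).toReal / (2 * r) ^ s) (𝓝[>] 0)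

section

/-! ### Binary core -/

def sgn (b : Bool) : ℝ := if b then 1 else -1

lemma sgn_true : sgn true = 1 := rfl
lemma sgn_false : sgn false = -1 := rfl
lemma sgn_not (b : Bool) : sgn (!b) = - sgn b := by cases b <;> simp [sgn]
lemma abs_sgn (b : Bool) : |sgn b| = 1 := by cases b <;> simp [sgn]
lemma sgn_mul_self (b : Bool) : sgn b * sgn b = 1 := by cases b <;> simp [sgn]

noncomputable def val (ρ : ℝ) (x : ℕ → Bool) : ℝ := ∑' i : ℕ, sgn (x i) * ρ ^ i

noncomputable def g (ρ : ℝ) (x : ℕ → Bool) (n : ℕ) : ℝ :=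
  sgn (x n) * val ρ (fun i => x (n + 1 + i))

lemma summable_val {ρ : ℝ} (h0 : 0 < ρ) (h1 : ρ < 1) (x : ℕ → Bool) :
    Summable (fun i : ℕ => sgn (x i) * ρ ^ i) := by
  apply Summable.of_norm_bounded (summable_geometric_of_lt_one h0.le h1)
  intro i
  rw [Real.norm_eq_abs, abs_mul, abs_sgn, one_mul, abs_of_pos (pow_pos h0 i)]

lemma val_succ {ρ : ℝ} (h0 : 0 < ρ) (h1 : ρ < 1) (x : ℕ → Bool) :
    val ρ x = sgn (x 0) + ρ * val ρ (fun i => x (i + 1)) := by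
  unfold val
  rw [(summable_val h0 h1 x).tsum_eq_zero_add, ← tsum_mul_left]
  simp only [pow_zero, mul_one]
  congr 1
  apply tsum_congr
  intro i
  ring

lemma abs_val_le {ρ : ℝ} (h0 : 0 < ρ) (h1 : ρ < 1) (x : ℕ → Bool) :
    |val ρ x| ≤ 1 / (1 - ρ) := by
  rw [one_div, ← tsum_geometric_of_lt_one h0.le h1, ← Real.norm_eq_abs]
  apply tsum_of_norm_bounded (summable_geometric_of_lt_one h0.le h1).hasSum
  intro i
  rw [Real.norm_eq_abs, abs_mul, abs_sgn, one_mul, abs_of_pos (pow_pos h0 i)]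

lemma abs_g_le {ρ : ℝ} (h0 : 0 < ρ) (h1 : ρ < 1) (x : ℕ → Bool) (n : ℕ) :
    |g ρ x n| ≤ 1 / (1 - ρ) := by
  unfold g
  rw [abs_mul, abs_sgn, one_mul]
  exact abs_val_le h0 h1 _

lemma g_rec {ρ : ℝ} (h0 : 0 < ρ) (h1 : ρ < 1) (x : ℕ → Bool) (n : ℕ) :
    g ρ x n = sgn (x n) * sgn (x (n + 1)) * (1 + ρ * g ρ x (n + 1)) := by
  unfold g
  rw [val_succ h0 h1]
  have : (fun i => x (n + 1 + (i + 1))) = fun i => x (n + 1 + 1 + i) := by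
    funext i; congr 1; ring
  simp only [this, add_zero]
  have := sgn_mul_self (x (n + 1))
  linear_combination (- sgn (x n) * ρ * val ρ (fun i => x (n + 1 + 1 + i))) * this

lemma one_add_g_pos {ρ : ℝ} (h0 : 0 < ρ) (h1 : ρ ≤ 1 / 4) (x : ℕ → Bool) (n : ℕ) :
    0 < 1 + ρ * g ρ x n := by
  have h := (abs_le.1 (abs_g_le h0 (by linarith) x n)).1
  have : 1 / (1 - ρ) ≤ 4 / 3 := by
    rw [div_le_div_iff₀ (by linarith) (by norm_num)]; linarith
  nlinarith

/-- the Thue-Morse substitution -/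
def sub (c : ℕ → Bool) (i : ℕ) : Bool := if i % 2 = 0 then c (i / 2) else !c (i / 2)

lemma sub_even (c : ℕ → Bool) (i : ℕ) : sub c (2 * i) = c i := by simp [sub]
lemma sub_odd (c : ℕ → Bool) (i : ℕ) : sub c (2 * i + 1) = !c i := by
  have h1 : (2 * i + 1) % 2 = 1 := by omega
  have h2 : (2 * i + 1) / 2 = i := by omega
  simp [sub, h1, h2]

lemma val_of_pairs {ρ : ℝ} (h0 : 0 < ρ) (h1 : ρ < 1) (x c : ℕ → Bool)
    (he : ∀ i, x (2 * i) = c i) (ho : ∀ i, x (2 * i + 1) = !c i) :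
    val ρ x = (1 - ρ) * val (ρ ^ 2) c := by
  have hs := summable_val h0 h1 x
  have h2 : Summable (fun i : ℕ => sgn (c i) * (ρ ^ 2) ^ i) :=
    summable_val (by positivity) (by nlinarith) c
  have he2 : ∀ i, (fun i : ℕ => sgn (x i) * ρ ^ i) (2 * i) = sgn (c i) * (ρ ^ 2) ^ i := by
    intro i; simp only [he, pow_mul]
  have ho2 : ∀ i, (fun i : ℕ => sgn (x i) * ρ ^ i) (2 * i + 1) =
      -ρ * (sgn (c i) * (ρ ^ 2) ^ i) := by
    intro i; simp only [ho, sgn_not, pow_succ, pow_mul]; ring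
  have key := tsum_even_add_odd (f := fun i : ℕ => sgn (x i) * ρ ^ i)
    ((summable_congr he2).2 h2) ((summable_congr ho2).2 (h2.mul_left _))
  rw [tsum_congr he2, tsum_congr ho2, tsum_mul_left] at key
  unfold val
  rw [← key]
  ring

lemma g_pairs_odd {ρ : ℝ} (h0 : 0 < ρ) (h1 : ρ < 1) (x c : ℕ → Bool) (k : ℕ)
    (he : ∀ i, x (k + 2 * i) = c i) (ho : ∀ i, x (k + 2 * i + 1) = !c i) (i : ℕ) :
    g ρ x (k + 2 * i + 1) = - (1 - ρ) * g (ρ ^ 2) c i := by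
  unfold g
  rw [ho, sgn_not, val_of_pairs h0 h1 _ (fun j => c (i + 1 + j))]
  · ring
  · intro j; rw [← he]; congr 1; ring
  · intro j; rw [← ho]; congr 1; ring

/-- iterated bounds -/
noncomputable def WW : ℕ → ℝ → ℝ → ℝ
  | 0, σ, ρ => σ * (1 / (1 - ρ))
  | n + 1, σ, ρ => (1 - ρ) * (1 + ρ ^ 2 * WW n σ (ρ ^ 2))

lemma sq_bd {ρ : ℝ} (h0 : 0 < ρ) (h1 : ρ ≤ 1 / 4) : 0 < ρ ^ 2 ∧ ρ ^ 2 ≤ 1 / 16 :=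
  ⟨by positivity, by nlinarith⟩

lemma step_le {ρ w : ℝ} (h0 : 0 < ρ) (h1 : ρ ≤ 1 / 4) (h : w ≤ 1 / (1 + ρ ^ 2)) :
    (1 - ρ) * (1 + ρ ^ 2 * w) ≤ 1 / (1 + ρ) := by
  have h2 : (1 - ρ) * (1 + ρ ^ 2 * w) ≤ (1 - ρ) * (1 + ρ ^ 2 * (1 / (1 + ρ ^ 2))) := by
    have : 0 ≤ 1 - ρ := by linarith
    gcongr
  refine h2.trans ?_
  have h3 : (1 - ρ) * (1 + ρ ^ 2 * (1 / (1 + ρ ^ 2))) = (1 - ρ) * (1 + 2 * ρ ^ 2) / (1 + ρ ^ 2) := by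
    field_simp; ring
  rw [h3, div_le_div_iff₀ (by positivity) (by linarith)]
  nlinarith [pow_pos h0 4]

lemma WW_le (n : ℕ) : ∀ {ρ : ℝ}, 0 < ρ → ρ ≤ 1 / 4 → WW n (-1) ρ ≤ 1 / (1 + ρ) := by
  induction n with
  | zero =>
    intro ρ h0 h1
    have : 0 < 1 / (1 - ρ) := by apply one_div_pos.2; linarith
    have : 0 < 1 / (1 + ρ) := by positivity
    simp only [WW]; linarith
  | succ n ih =>
    intro ρ h0 h1
    exact step_le h0 h1 (ih (sq_bd h0 h1).1 (by linarith [(sq_bd h0 h1).2]))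

lemma WW_nonneg (n : ℕ) : ∀ {ρ : ℝ}, 0 < ρ → ρ ≤ 1 / 4 → 0 ≤ WW n 1 ρ := by
  induction n with
  | zero =>
    intro ρ h0 h1
    have : 0 < 1 / (1 - ρ) := by apply one_div_pos.2; linarith
    simp only [WW]; linarith
  | succ n ih =>
    intro ρ h0 h1
    have := ih (sq_bd h0 h1).1 (by linarith [(sq_bd h0 h1).2])
    have h2 : 0 ≤ 1 - ρ := by linarith
    simp only [WW]; positivity

/-- Thue-Morse sequence with `tm 0 = false`. -/
def tm : ℕ → Bool
  | 0 => false
  | n + 1 => if (n + 1) % 2 = 0 then tm ((n + 1) / 2) else !tm ((n + 1) / 2)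
decreasing_by all_goals omega

lemma tm_zero : tm 0 = false := by rw [tm]
lemma tm_even (i : ℕ) : tm (2 * i) = tm i := by
  rcases i with _ | i
  · rfl
  · rw [show 2 * (i + 1) = (2 * i + 1) + 1 by ring, tm, if_pos (by omega)]
    congr 1; omega
lemma tm_odd (i : ℕ) : tm (2 * i + 1) = !tm i := by
  rw [tm, if_neg (by omega)]
  congr 2; omega
lemma tm_one : tm 1 = true := by
  have := tm_odd 0; simpa [tm_zero] using this

lemma tm_add (n : ℕ) : ∀ j, j < 2 ^ n → tm (2 ^ n + j) = !tm j := by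
  induction n with
  | zero => intro j hj; have : j = 0 := by simpa using hj
            subst this; simp [tm_one, tm_zero]
  | succ n ih =>
    intro j hj
    rcases Nat.even_or_odd' j with ⟨i, rfl | rfl⟩
    · rw [show 2 ^ (n + 1) + 2 * i = 2 * (2 ^ n + i) by ring, tm_even, tm_even, ih]
      rw [pow_succ] at hj; omega
    · rw [show 2 ^ (n + 1) + (2 * i + 1) = 2 * (2 ^ n + i) + 1 by ring, tm_odd, tm_odd, ih]
      rw [pow_succ] at hj; omega

noncomputable def W (ρ : ℝ) : ℝ := val ρ (fun i => tm (i + 2))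

lemma W_rec {ρ : ℝ} (h0 : 0 < ρ) (h1 : ρ ≤ 1 / 4) :
    W ρ = (1 - ρ) * (1 + ρ ^ 2 * W (ρ ^ 2)) := by
  unfold W
  rw [val_of_pairs h0 (by linarith) (fun i => tm (i + 2)) (fun i => tm (i + 1))]
  · rw [val_succ (sq_bd h0 h1).1 (by linarith [(sq_bd h0 h1).2])]
    simp [tm_one, sgn_true]
  · intro i; exact tm_even (i + 1)
  · intro i; exact tm_odd (i + 1)

lemma W_abs_le {ρ : ℝ} (h0 : 0 < ρ) (h1 : ρ ≤ 1 / 4) : |W ρ| ≤ 1 / (1 - ρ) :=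
  abs_val_le h0 (by linarith) _

lemma W_le {ρ : ℝ} (h0 : 0 < ρ) (h1 : ρ ≤ 1 / 4) : W ρ ≤ 1 := by
  have h := (abs_le.1 (W_abs_le (sq_bd h0 h1).1 (by linarith [(sq_bd h0 h1).2]))).2
  have h2 : 1 / (1 - ρ ^ 2) ≤ 2 := by
    rw [div_le_iff₀ (by nlinarith)]; nlinarith
  rw [W_rec h0 h1]
  have h3 : ρ ^ 2 * W (ρ ^ 2) ≤ ρ ^ 2 * 2 := by gcongr; linarith
  have h4 : 0 < 1 - ρ := by linarith
  calc (1 - ρ) * (1 + ρ ^ 2 * W (ρ ^ 2)) ≤ (1 - ρ) * (1 + ρ ^ 2 * 2) := by gcongr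
    _ ≤ 1 := by nlinarith [pow_pos h0 3]

lemma WW_close (n : ℕ) : ∀ {ρ : ℝ} (σ : ℝ), |σ| = 1 → 0 < ρ → ρ ≤ 1 / 4 →
    |WW n σ ρ - W ρ| ≤ 4 * (1 / 2) ^ n := by
  induction n with
  | zero =>
    intro ρ σ hσ h0 h1
    have h2 : 1 / (1 - ρ) ≤ 2 := by
      rw [div_le_iff₀ (by linarith)]; linarith
    have h3 : 0 < 1 / (1 - ρ) := by apply one_div_pos.2; linarith
    have h4 : |WW 0 σ ρ| ≤ 2 := by
      simp only [WW]; rw [abs_mul, hσ, one_mul, abs_of_pos h3]; exact h2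
    have := abs_sub (WW 0 σ ρ) (W ρ)
    have := W_abs_le h0 h1
    simp only [pow_zero]; linarith
  | succ n ih =>
    intro ρ σ hσ h0 h1
    have h2 := ih σ hσ (sq_bd h0 h1).1 (by linarith [(sq_bd h0 h1).2])
    rw [W_rec h0 h1]
    simp only [WW]
    rw [show (1 - ρ) * (1 + ρ ^ 2 * WW n σ (ρ ^ 2)) - (1 - ρ) * (1 + ρ ^ 2 * W (ρ ^ 2)) =
      ((1 - ρ) * ρ ^ 2) * (WW n σ (ρ ^ 2) - W (ρ ^ 2)) by ring, abs_mul,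
      abs_of_nonneg (mul_nonneg (by linarith) (by positivity)), pow_succ]
    have h5 : (1 - ρ) * ρ ^ 2 ≤ 1 / 2 := by nlinarith
    have h6 : (0:ℝ) ≤ 4 * (1 / 2) ^ n := by positivity
    calc _ ≤ 1 / 2 * (4 * (1 / 2) ^ n) := mul_le_mul h5 h2 (abs_nonneg _) (by norm_num)
      _ = _ := by ring

lemma WW_tendsto {ρ : ℝ} (σ : ℝ) (hσ : |σ| = 1) (h0 : 0 < ρ) (h1 : ρ ≤ 1 / 4) :
    Tendsto (fun n => WW n σ ρ) atTop (𝓝 (W ρ)) := by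
  rw [tendsto_iff_dist_tendsto_zero]
  refine squeeze_zero (fun _ => dist_nonneg) (fun n => WW_close n σ hσ h0 h1) ?_
  have := (tendsto_pow_atTop_nhds_zero_of_lt_one (r := (1/2:ℝ)) (by norm_num) (by norm_num)).const_mul 4
  simpa using this

/-! ### Countability -/

lemma countable_tail {α : Type*} [Countable α] (y : ℕ → α) (k : ℕ) :
    {x : ℕ → α | ∀ i, x (k + i) = y i}.Countable := by
  have : Set.InjOn (fun (x : ℕ → α) (i : Fin k) => x i) {x : ℕ → α | ∀ i, x (k + i) = y i} := by
    intro x hx x' hx' h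
    funext n
    by_cases hn : n < k
    · exact congrFun h ⟨n, hn⟩
    · obtain ⟨m, rfl⟩ := Nat.exists_eq_add_of_le (not_lt.1 hn)
      rw [hx m, hx' m]
  exact Set.countable_of_injective_of_countable_image this (Set.to_countable _)

lemma pairs_step {ρ : ℝ} (h0 : 0 < ρ) (h1 : ρ ≤ 1 / 4) (x : ℕ → Bool) (k : ℕ)
    (hg : ∀ n, k ≤ n → g ρ x n < 1 / (1 + ρ)) (hk : x k = x (k + 1)) (i : ℕ) :
    g ρ x (k + 1 + 2 * i) < - (1 / (1 + ρ)) := by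
  have hv : 1 / (1 + ρ) * (1 + ρ) = 1 := by field_simp
  set v := 1 / (1 + ρ) with hvdef
  have key : ∀ n, k ≤ n → x n = x (n + 1) → g ρ x (n + 1) < - v := by
    intro n hn h
    have h2 := g_rec h0 (by linarith) x n
    rw [← h, sgn_mul_self, one_mul] at h2
    have h3 := hg n hn
    by_contra h4
    push Not at h4
    nlinarith
  have neg : ∀ n, g ρ x n < - v → g ρ x (n+1) > - v := by
    intro n h
    have h2 := g_rec h0 (by linarith) x n
    have h3 := one_add_g_pos h0 h1 x (n + 1)
    have hvp : 0 < v := by positivity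
    by_contra h4
    push Not at h4
    cases h5 : x n <;> cases h6 : x (n + 1) <;> rw [h5, h6] at h2 <;> simp only [sgn] at h2 <;>
      norm_num at h2 <;> nlinarith
  induction i with
  | zero => simpa using key k le_rfl hk
  | succ i ih =>
    rw [show k + 1 + 2 * (i + 1) = k + 1 + 2 * i + 1 + 1 by ring]
    set m := k + 1 + 2 * i with hm
    have h2 := neg m ih
    by_cases h : x (m + 1) = x (m + 1 + 1)
    · exact key (m + 1) (by omega) h
    · have h3 := g_rec h0 (by linarith) x (m + 1)
      have h4 : sgn (x (m + 1)) * sgn (x (m + 1 + 1)) = -1 := by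
        revert h; cases x (m + 1) <;> cases x (m + 1 + 1) <;> simp [sgn]
      rw [h4] at h3
      by_contra h5
      push Not at h5
      nlinarith

lemma pairs_neg {ρ : ℝ} (h0 : 0 < ρ) (h1 : ρ ≤ 1 / 4) (x : ℕ → Bool) (n : ℕ)
    (h : g ρ x n < 0) : x (n + 1) = !x n := by
  have h2 := g_rec h0 (by linarith) x n
  have h3 := one_add_g_pos h0 h1 x (n + 1)
  cases h5 : x n <;> cases h6 : x (n + 1) <;> rw [h5, h6] at h2 <;> simp only [sgn] at h2 <;>
      norm_num at h2 ⊢ <;> nlinarith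

lemma countable_core (n : ℕ) : ∀ {ρ : ℝ}, 0 < ρ → ρ ≤ 1 / 4 →
    {x : ℕ → Bool | ∃ k, ∀ m, k ≤ m → g ρ x m < WW n (-1) ρ}.Countable := by
  induction n with
  | zero =>
    intro ρ h0 h1
    convert Set.countable_empty
    rw [Set.eq_empty_iff_forall_notMem]
    rintro x ⟨k, hk⟩
    have := hk k le_rfl
    have h2 := (abs_le.1 (abs_g_le h0 (by linarith) x k)).1
    simp only [WW] at this
    linarith
  | succ n ih =>
    intro ρ h0 h1
    have q0 := (sq_bd h0 h1).1
    have q1 : ρ ^ 2 ≤ 1 / 4 := by linarith [(sq_bd h0 h1).2]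
    set C := {x : ℕ → Bool | ∃ k, ∀ m, k ≤ m → g (ρ ^ 2) x m < WW n (-1) (ρ ^ 2)} with hC
    have hCc : C.Countable := ih q0 q1
    set C' : Set (ℕ → Bool) := C ∪ {fun _ => true, fun _ => false} with hC'
    have hCc' : C'.Countable := hCc.union (Set.toFinite _).countable
    have hbig : (⋃ c ∈ C', ⋃ k : ℕ, {x : ℕ → Bool | ∀ i, x (k + i) = sub c i}).Countable :=
      hCc'.biUnion fun c _ => Set.countable_iUnion fun k => countable_tail _ k
    have mem_of : ∀ (x c : ℕ → Bool) (k : ℕ), c ∈ C' → (∀ i, x (k + 2 * i) = c i) →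
        (∀ i, x (k + 2 * i + 1) = !c i) →
        x ∈ (⋃ c ∈ C', ⋃ k : ℕ, {x : ℕ → Bool | ∀ i, x (k + i) = sub c i}) := by
      intro x c k hc he ho
      simp only [Set.mem_iUnion]
      refine ⟨c, hc, k, fun i => ?_⟩
      rcases Nat.even_or_odd' i with ⟨j, rfl | rfl⟩
      · rw [he, sub_even]
      · rw [← add_assoc, ho, sub_odd]
    have const_mem : ∀ (c : ℕ → Bool) , (∀ i, c (i + 1) = c i) → c ∈ C' := by
      intro c h
      have h2 : ∀ i, c i = c 0 := by
        intro i; induction i with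
        | zero => rfl
        | succ i ih => rw [h, ih]
      right
      cases h3 : c 0 with
      | true => left; funext i; rw [h2, h3]
      | false => right; funext i; rw [h2, h3]
    refine hbig.mono ?_
    rintro x ⟨k0, hx⟩
    by_cases halt : ∀ m, k0 ≤ m → x m ≠ x (m + 1)
    · have h3 : ∀ m, k0 ≤ m → x (m + 1) = !x m := by
        intro m hm; have := halt m hm
        revert this; cases x m <;> cases x (m + 1) <;> simp
      refine mem_of x (fun i => x (k0 + 2 * i)) k0 (const_mem _ ?_) (fun i => rfl) ?_
      · intro i
        show x (k0 + 2 * (i + 1)) = x (k0 + 2 * i)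
        rw [show k0 + 2 * (i + 1) = k0 + 2 * i + 1 + 1 by ring, h3 _ (by omega), h3 _ (by omega)]
        simp
      · intro i; exact h3 _ (by omega)
    push Not at halt
    obtain ⟨k, hk, hkk⟩ := halt
    have hp := pairs_step h0 h1 x k (fun m hm => (hx m (hk.trans hm)).trans_le (WW_le (n + 1) h0 h1)) hkk
    have ho : ∀ i, x (k + 1 + 2 * i + 1) = !x (k + 1 + 2 * i) := fun i => by
      apply pairs_neg h0 h1
      have := hp i
      have : 0 < 1 / (1 + ρ) := by positivity
      linarith
    refine mem_of x (fun i => x (k + 1 + 2 * i)) (k + 1) ?_ (fun i => rfl) ho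
    set c : ℕ → Bool := fun i => x (k + 1 + 2 * i) with hc
    have hgc : ∀ i, - g (ρ ^ 2) c i < 1 + ρ ^ 2 * WW n (-1) (ρ ^ 2) := by
      intro i
      have h2 := g_pairs_odd h0 (by linarith) x c (k + 1) (fun i => rfl) ho i
      have h3 := hx (k + 1 + 2 * i + 1) (by omega)
      rw [h2] at h3
      simp only [WW] at h3
      have h4 : 0 < 1 - ρ := by linarith
      nlinarith
    by_cases hcon : ∀ i, c (i + 1) = c i
    · exact const_mem c hcon
    left
    push Not at hcon
    obtain ⟨i0, hi0⟩ := hcon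
    have hneg : ∀ i, c (i + 1) ≠ c i → g (ρ ^ 2) c (i + 1) < WW n (-1) (ρ ^ 2) := by
      intro i hi
      have h3 := g_rec q0 (by linarith) c i
      have h4 : sgn (c i) * sgn (c (i + 1)) = -1 := by
        revert hi; cases c i <;> cases c (i + 1) <;> simp [sgn]
      rw [h4] at h3
      have := hgc i
      nlinarith
    refine ⟨i0 + 1, fun m hm => ?_⟩
    induction m, hm using Nat.le_induction with
    | base => exact hneg i0 hi0
    | succ m hm ih2 =>
      by_cases hi : c (m + 1) = c m
      · have h3 := g_rec q0 (by linarith) c m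
        rw [hi, sgn_mul_self, one_mul] at h3
        have h4 := WW_le n q0 q1
        set w := WW n (-1) (ρ ^ 2)
        have h5 : w * (1 - ρ ^ 2) ≤ 1 := by
          rw [le_div_iff₀ (by positivity)] at h4
          by_cases hw : 0 ≤ w
          · nlinarith
          · push Not at hw; nlinarith
        by_contra h6
        push Not at h6
        nlinarith
      · exact hneg m hi

/-! ### Upper bounds for substituted sequences -/

lemma g_sub_le {ρ U : ℝ} (h0 : 0 < ρ) (h1 : ρ ≤ 1 / 4) (hU : 0 ≤ U) (x c : ℕ → Bool) (k i0 : ℕ)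
    (he : ∀ i, x (k + 2 * i) = c i) (ho : ∀ i, x (k + 2 * i + 1) = !c i)
    (hc : ∀ i, i0 ≤ i → g (ρ ^ 2) c i ≤ U) (m : ℕ) (hm : k + 2 * i0 ≤ m) :
    g ρ x m ≤ (1 - ρ) * (1 + ρ ^ 2 * U) := by
  have q0 := (sq_bd h0 h1).1
  have q1 : ρ ^ 2 ≤ 1 / 4 := by linarith [(sq_bd h0 h1).2]
  have hr : 0 < 1 - ρ := by linarith
  have hpos : 0 ≤ (1 - ρ) * (1 + ρ ^ 2 * U) := by positivity
  obtain ⟨j, rfl⟩ := Nat.exists_eq_add_of_le (show k ≤ m by omega)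
  rcases Nat.even_or_odd' j with ⟨i, rfl | rfl⟩
  · have h3 := g_rec h0 (by linarith) x (k + 2 * i)
    rw [ho, he, sgn_not, mul_neg, sgn_mul_self] at h3
    have := one_add_g_pos h0 h1 x (k + 2 * i + 1)
    linarith
  · rw [← add_assoc, g_pairs_odd h0 (by linarith) x c k he ho i]
    have h3 := g_rec q0 (by linarith) c i
    have h4 := one_add_g_pos q0 q1 c (i + 1)
    by_cases hi : c i = c (i + 1)
    · rw [← hi, sgn_mul_self, one_mul] at h3
      nlinarith
    · have h5 : sgn (c i) * sgn (c (i + 1)) = -1 := by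
        revert hi; cases c i <;> cases c (i + 1) <;> simp [sgn]
      rw [h5] at h3
      rw [h3]
      have := hc (i + 1) (by omega)
      have : 1 + ρ ^ 2 * g (ρ ^ 2) c (i + 1) ≤ 1 + ρ ^ 2 * U := by gcongr
      nlinarith

/-- iterated substitution -/
def isub : ℕ → (ℕ → Bool) → (ℕ → Bool)
  | 0, c => c
  | n + 1, c => sub (isub n c)

lemma g_isub_le (n : ℕ) : ∀ {ρ : ℝ}, 0 < ρ → ρ ≤ 1 / 4 → ∀ (c : ℕ → Bool) (m : ℕ),
    g ρ (isub n c) m ≤ WW n 1 ρ := by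
  induction n with
  | zero =>
    intro ρ h0 h1 c m
    have := (abs_le.1 (abs_g_le h0 (by linarith) c m)).2
    simpa [WW, isub] using this
  | succ n ih =>
    intro ρ h0 h1 c m
    have q0 := (sq_bd h0 h1).1
    have q1 : ρ ^ 2 ≤ 1 / 4 := by linarith [(sq_bd h0 h1).2]
    exact g_sub_le h0 h1 (WW_nonneg n q0 q1) (isub (n + 1) c) (isub n c) 0 0
      (fun i => by simp [isub, sub_even]) (fun i => by simp [isub, sub_odd])
      (fun i _ => ih q0 q1 c i) m (by omega)

lemma val_isub (n : ℕ) : ∀ {ρ : ℝ}, 0 < ρ → ρ ≤ 1 / 4 → ∃ B : ℝ, 0 < B ∧ ∀ c : ℕ → Bool,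
    val ρ (isub n c) = B * val (ρ ^ (2 ^ n)) c := by
  induction n with
  | zero => intro ρ _ _; exact ⟨1, one_pos, fun c => by simp [isub]⟩
  | succ n ih =>
    intro ρ h0 h1
    have q0 := (sq_bd h0 h1).1
    have q1 : ρ ^ 2 ≤ 1 / 4 := by linarith [(sq_bd h0 h1).2]
    obtain ⟨B, hB, h⟩ := ih q0 q1
    refine ⟨(1 - ρ) * B, mul_pos (by linarith) hB, fun c => ?_⟩
    rw [val_of_pairs h0 (by linarith) _ (isub n c) (fun i => by simp [isub, sub_even])
      (fun i => by simp [isub, sub_odd]), h, ← pow_mul, pow_succ' 2 n]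
    ring

lemma isub_zero (n : ℕ) (c : ℕ → Bool) : isub n c 0 = c 0 := by
  induction n with
  | zero => rfl
  | succ n ih => simpa [isub, sub] using ih

/-- nested construction for the critical case -/
def gen (c : ℕ → Bool) (k : ℕ) : Bool :=
  if h : k = 0 then c 0
  else if k % 2 = 1 then gen (fun i => c (i + 1)) (k / 2)
  else !gen (fun i => c (i + 1)) (k / 2 - 1)
termination_by k
decreasing_by all_goals omega

lemma gen_zero (c : ℕ → Bool) : gen c 0 = c 0 := by rw [gen]; simp
lemma gen_odd (c : ℕ → Bool) (i : ℕ) : gen c (1 + 2 * i) = gen (fun i => c (i + 1)) i := by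
  rw [gen, dif_neg (by omega), if_pos (by omega)]; congr 1; omega
lemma gen_even (c : ℕ → Bool) (i : ℕ) : gen c (1 + 2 * i + 1) = !gen (fun i => c (i + 1)) i := by
  rw [gen, dif_neg (by omega), if_neg (by omega)]; congr 2; omega

lemma gen_inj_aux (n : ℕ) : ∀ c c' : ℕ → Bool, gen c = gen c' → c n = c' n := by
  induction n with
  | zero => intro c c' h; rw [← gen_zero c, h, gen_zero]
  | succ n ih =>
    intro c c' h
    apply ih (fun i => c (i + 1)) (fun i => c' (i + 1))
    funext i
    rw [← gen_odd, h, gen_odd]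

lemma g_gen_le (n : ℕ) : ∀ {ρ : ℝ}, 0 < ρ → ρ ≤ 1 / 4 → ∀ (c : ℕ → Bool), ∃ k, ∀ m, k ≤ m →
    g ρ (gen c) m ≤ WW n 1 ρ := by
  induction n with
  | zero =>
    intro ρ h0 h1 c
    refine ⟨0, fun m _ => ?_⟩
    have := (abs_le.1 (abs_g_le h0 (by linarith) (gen c) m)).2
    simpa [WW] using this
  | succ n ih =>
    intro ρ h0 h1 c
    have q0 := (sq_bd h0 h1).1
    have q1 : ρ ^ 2 ≤ 1 / 4 := by linarith [(sq_bd h0 h1).2]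
    obtain ⟨i0, hi⟩ := ih q0 q1 (fun i => c (i + 1))
    exact ⟨1 + 2 * i0, g_sub_le h0 h1 (WW_nonneg n q0 q1) (gen c) _ 1 i0 (gen_odd c) (gen_even c) hi⟩

/-! ### Separation and dimension -/

lemma val_sep {ρ : ℝ} (h0 : 0 < ρ) (h1 : ρ ≤ 1 / 4) (m : ℕ) : ∀ (x y : ℕ → Bool),
    (∀ i < m, x i = y i) → x m ≠ y m → ρ ^ m ≤ |val ρ x - val ρ y| := by
  induction m with
  | zero =>
    intro x y _ h
    rw [val_succ h0 (by linarith) x, val_succ h0 (by linarith) y]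
    have hx := abs_le.1 (abs_val_le h0 (by linarith) (fun i => x (i + 1)))
    have hy := abs_le.1 (abs_val_le h0 (by linarith) (fun i => y (i + 1)))
    have h2 : 1 / (1 - ρ) ≤ 4 / 3 := by
      rw [div_le_div_iff₀ (by linarith) (by norm_num)]; linarith
    set a := val ρ (fun i => x (i + 1))
    set b := val ρ (fun i => y (i + 1))
    have h3 : |ρ * (a - b)| ≤ 2 / 3 := by
      rw [abs_mul, abs_of_pos h0]
      have : |a - b| ≤ 8 / 3 := abs_le.2 ⟨by linarith, by linarith⟩
      calc ρ * |a - b| ≤ 1 / 4 * (8 / 3) := mul_le_mul h1 this (abs_nonneg _) (by norm_num)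
        _ = 2 / 3 := by norm_num
    have h4 := abs_le.1 h3
    rw [pow_zero]
    cases hx0 : x 0 <;> cases hy0 : y 0
    · exact absurd (hx0.trans hy0.symm) h
    · simp only [sgn]; rw [abs_of_nonpos] <;> norm_num <;> linarith
    · simp only [sgn]; rw [abs_of_nonneg] <;> norm_num <;> linarith
    · exact absurd (hx0.trans hy0.symm) h
  | succ m ih =>
    intro x y hxy h
    rw [val_succ h0 (by linarith) x, val_succ h0 (by linarith) y, hxy 0 (by omega)]
    have := ih (fun i => x (i + 1)) (fun i => y (i + 1)) (fun i hi => hxy _ (by omega)) h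
    rw [show ∀ a b : ℝ, sgn (y 0) + ρ * a - (sgn (y 0) + ρ * b) = ρ * (a - b) by intros; ring,
      abs_mul, abs_of_pos h0, pow_succ']
    exact mul_le_mul_of_nonneg_left this h0.le

lemma exists_first_diff {x y : ℕ → Bool} (h : x ≠ y) : ∃ m, (∀ i < m, x i = y i) ∧ x m ≠ y m := by
  have h2 : ∃ m, x m ≠ y m := by
    by_contra h3; push Not at h3; exact h (funext h3)
  classical
  exact ⟨Nat.find h2, fun i hi => by simpa using Nat.find_min h2 hi, Nat.find_spec h2⟩

lemma val_inj {ρ : ℝ} (h0 : 0 < ρ) (h1 : ρ ≤ 1 / 4) : Function.Injective (val ρ) := by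
  intro x y h
  by_contra hne
  obtain ⟨m, h2, h3⟩ := exists_first_diff hne
  have := val_sep h0 h1 m x y h2 h3
  rw [h, sub_self, abs_zero] at this
  have := pow_pos h0 m
  linarith


end

section

lemma dim_pos {Q K : ℝ} (h0 : 0 < Q) (h1 : Q ≤ 1 / 4) (hK : 0 < K) (P : (ℕ → Bool) → ℝ) (s : Set ℝ)
    (hs : ∀ c, P c ∈ s) (hP : ∀ c c', K * |val Q c - val Q c'| ≤ |P c - P c'|) : 0 < dimH s := by
  have hinj : Function.Injective P := by
    intro c c' h
    apply val_inj h0 h1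
    have h2 := hP c c'
    rw [h, sub_self, abs_zero] at h2
    have h3 : |val Q c - val Q c'| = 0 := le_antisymm (by
      by_contra h4; push Not at h4; nlinarith) (abs_nonneg _)
    linarith [abs_eq_zero.1 h3]
  set α : ℝ := Real.log 2 / (- Real.log Q) with hα
  have hlQ : 0 < - Real.log Q := by
    have := Real.log_neg h0 (by linarith); linarith
  have hlne : Real.log Q ≠ 0 := by linarith
  have hα0 : 0 < α := div_pos (Real.log_pos (by norm_num)) hlQ
  have hQα : Q ^ α = 1 / 2 := by
    rw [Real.rpow_def_of_pos h0, hα, show Real.log Q * (Real.log 2 / -Real.log Q) = - Real.log 2 by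
      field_simp, Real.exp_neg, Real.exp_log (by norm_num)]
    norm_num
  let bin : (ℕ → Bool) → ℝ := fun c => Real.ofDigits (fun i => finTwoEquiv.symm (c i))
  let h : ℝ → ℝ := fun p => bin (Function.invFun P p)
  have hh : ∀ c, h (P c) = bin c := fun c => by
    simp only [h]; rw [Function.leftInverse_invFun hinj c]
  set C : ℝ := (1 / K) ^ α with hC
  have hC0 : 0 ≤ C := by positivity
  have hold : HolderOnWith C.toNNReal α.toNNReal h (range P) := by
    rintro _ ⟨c, rfl⟩ _ ⟨c', rfl⟩
    by_cases hcc : c = c'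
    · subst hcc; simp
    obtain ⟨m, hm1, hm2⟩ := exists_first_diff hcc
    have h3 := val_sep h0 h1 m c c' hm1 hm2
    rw [hh, hh, edist_dist, edist_dist, Real.coe_toNNReal _ hα0.le,
      ENNReal.ofReal_rpow_of_nonneg dist_nonneg hα0.le, ← ENNReal.ofReal_coe_nnreal,
      Real.coe_toNNReal _ hC0, ← ENNReal.ofReal_mul hC0]
    apply ENNReal.ofReal_le_ofReal
    rw [hC, ← Real.mul_rpow (by positivity) dist_nonneg]
    have h4 : Q ^ m ≤ 1 / K * dist (P c) (P c') := by
      rw [Real.dist_eq, one_div, inv_mul_eq_div, le_div_iff₀ hK]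
      have := hP c c'
      nlinarith
    calc dist (bin c) (bin c') ≤ (((2 : ℕ) : ℝ) ^ m)⁻¹ :=
          Real.abs_ofDigits_sub_ofDigits_le (fun i hi => by rw [hm1 i hi])
      _ = (Q ^ m) ^ α := by
          rw [← Real.rpow_natCast Q, ← Real.rpow_mul h0.le, mul_comm, Real.rpow_mul h0.le, hQα,
            Real.rpow_natCast]; simp
      _ ≤ _ := Real.rpow_le_rpow (by positivity) h4 hα0.le
  have him := hold.dimH_image_le (by simpa using hα0)
  have hsub : Icc (0:ℝ) 1 ⊆ h '' range P := by
    intro y hy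
    obtain ⟨dd, -, hd⟩ := Real.ofDigits_SurjOn (b := 2) (by norm_num) hy
    refine ⟨P (fun i => finTwoEquiv (dd i)), ⟨_, rfl⟩, ?_⟩
    rw [hh]
    simp only [bin, Equiv.symm_apply_apply]
    exact hd
  have h1' : dimH (Icc (0:ℝ) 1) = 1 := by
    have := Real.dimH_of_mem_nhds (E := ℝ) (x := 1/2) (s := Icc (0:ℝ) 1)
      (Icc_mem_nhds (by norm_num) (by norm_num))
    simpa using this
  by_contra hcon
  have hz : dimH s = 0 := le_antisymm (not_lt.1 hcon) bot_le
  have hz2 : dimH (range P) = 0 := le_antisymm (hz ▸ dimH_mono (by rintro _ ⟨c, rfl⟩; exact hs c)) bot_le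
  rw [hz2, ENNReal.zero_div] at him
  have := (dimH_mono hsub).trans him
  rw [h1'] at this
  simp at this


end

section

/-- standing assumptions, real form -/
structure Par (N : ℕ) (ρ : ℝ) : Prop where
  hN : 2 ≤ N
  h0 : 0 < ρ
  h1 : ρ * (N : ℝ) ^ 2 ≤ 1

namespace Par
variable {N : ℕ} {ρ : ℝ}
lemma N2 (p : Par N ρ) : (2 : ℝ) ≤ N := by exact_mod_cast p.hN
lemma quarter (p : Par N ρ) : ρ ≤ 1 / 4 := by
  have := p.N2; have := p.h1; have := p.h0
  have h4 : (4:ℝ) ≤ (N:ℝ) ^ 2 := by nlinarith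
  nlinarith
lemma R_eq (p : Par N ρ) : ((N : ℝ) - 1) * R N ρ = 1 - ρ := by
  have := p.N2
  unfold R; field_simp [show (N:ℝ) - 1 ≠ 0 by linarith]
lemma R_pos (p : Par N ρ) : 0 < R N ρ := by
  have := p.N2; have := p.quarter
  unfold R; apply div_pos <;> linarith
/-- `R / ρ ≥ N + 1`. -/
lemma R_ge (p : Par N ρ) : (N + 1) * ρ ≤ R N ρ := by
  have h2 := p.N2
  unfold R
  rw [le_div_iff₀ (by linarith)]
  nlinarith [p.h1]
lemma N_rho (p : Par N ρ) : N * ρ ≤ 1 / 2 := by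
  have := p.N2; have := p.h1; have := p.h0
  nlinarith
end Par

variable {N : ℕ} {ρ : ℝ} {μ : Measure ℝ}

lemma f_cont (i : ℕ) : Continuous (f N ρ i) := by unfold f; fun_prop

lemma mass (p : Par N ρ) [IsProbabilityMeasure μ] (hss : IsSelfSimilar N ρ μ) {A : Set ℝ}
    (hA : MeasurableSet A) :
    (N : ℝ) * μ.real A = ∑ i ∈ Finset.range N, μ.real (f N ρ i ⁻¹' A) := by
  have h : μ A = ∑ i ∈ Finset.range N, (N : ℝ≥0∞)⁻¹ * μ (f N ρ i ⁻¹' A) := by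
    conv_lhs => rw [hss]
    rw [Measure.finsetSum_apply]
    refine Finset.sum_congr rfl fun i _ => ?_
    rw [Measure.smul_apply, Measure.map_apply (f_cont i).measurable hA, smul_eq_mul]
  have hN : (N : ℝ) ≠ 0 := by have := p.N2; linarith
  unfold Measure.real
  rw [h, ENNReal.toReal_sum, Finset.mul_sum]
  · refine Finset.sum_congr rfl fun i _ => ?_
    rw [ENNReal.toReal_mul, ENNReal.toReal_inv, ENNReal.toReal_natCast]
    field_simp
  · intro i _
    apply ENNReal.mul_ne_top
    · have := p.hN; simp; omega
    · exact measure_ne_top _ _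

lemma tendsto_real_Iic [IsProbabilityMeasure μ] : Tendsto (fun x => μ.real (Iic x)) atBot (𝓝 0) := by
  have := ProbabilityTheory.tendsto_cdf_atBot μ
  exact this.congr fun x => ProbabilityTheory.cdf_eq_real μ x

lemma tendsto_real_Ioi [IsProbabilityMeasure μ] : Tendsto (fun x => μ.real (Ioi x)) atTop (𝓝 0) := by
  have := (ProbabilityTheory.tendsto_cdf_atTop μ).const_sub 1
  simp only [ProbabilityTheory.cdf_eq_real, sub_self] at this
  refine this.congr fun x => ?_
  rw [← compl_Iic, probReal_compl_eq_one_sub measurableSet_Iic]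

lemma mass_le_of (p : Par N ρ) [IsProbabilityMeasure μ] (hss : IsSelfSimilar N ρ μ) {A B : Set ℝ}
    (hA : MeasurableSet A) (h : ∀ i < N, f N ρ i ⁻¹' A ⊆ B) : μ.real A ≤ μ.real B := by
  have h1 := mass p hss hA
  have h2 : ∑ i ∈ Finset.range N, μ.real (f N ρ i ⁻¹' A) ≤ ∑ i ∈ Finset.range N, μ.real B :=
    Finset.sum_le_sum fun i hi => measureReal_mono (h i (Finset.mem_range.1 hi))
  rw [Finset.sum_const, Finset.card_range, nsmul_eq_mul, ← h1] at h2
  have := p.N2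
  exact le_of_mul_le_mul_left h2 (by linarith)

lemma f_le (p : Par N ρ) {i : ℕ} (hi : i < N) : 0 ≤ (i : ℝ) * R N ρ ∧ (i : ℝ) * R N ρ ≤ 1 - ρ := by
  have := p.R_pos
  refine ⟨by positivity, ?_⟩
  rw [← p.R_eq]
  have : (i : ℝ) + 1 ≤ N := by exact_mod_cast hi
  gcongr
  linarith

lemma mass_neg (p : Par N ρ) [IsProbabilityMeasure μ] (hss : IsSelfSimilar N ρ μ) {ε : ℝ}
    (hε : 0 < ε) : μ.real (Iic (-ε)) = 0 := by
  have hρ := p.h0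
  have h1 : ∀ n : ℕ, μ.real (Iic (-ε)) ≤ μ.real (Iic (-(ε * (1 / ρ) ^ n))) := by
    intro n
    induction n with
    | zero => simp
    | succ n ih =>
      refine ih.trans (mass_le_of p hss measurableSet_Iic ?_)
      intro i hi x hx
      simp only [mem_preimage, mem_Iic, f] at hx ⊢
      have := (f_le p hi).1
      rw [pow_succ, ← mul_assoc, mul_one_div, ← neg_div, le_div_iff₀ hρ]
      linarith
  have h2 : Tendsto (fun n : ℕ => -(ε * (1 / ρ) ^ n)) atTop atBot := by
    apply tendsto_neg_atTop_atBot.comp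
    apply Tendsto.const_mul_atTop hε
    apply tendsto_pow_atTop_atTop_of_one_lt
    rw [lt_div_iff₀ hρ]; linarith [p.quarter]
  exact le_antisymm (ge_of_tendsto' (tendsto_real_Iic.comp h2) h1) measureReal_nonneg

lemma mass_pos (p : Par N ρ) [IsProbabilityMeasure μ] (hss : IsSelfSimilar N ρ μ) {ε : ℝ}
    (hε : 0 < ε) : μ.real (Ioi (1 + ε)) = 0 := by
  have hρ := p.h0
  have h1 : ∀ n : ℕ, μ.real (Ioi (1 + ε)) ≤ μ.real (Ioi (1 + (ε * (1 / ρ) ^ n))) := by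
    intro n
    induction n with
    | zero => simp
    | succ n ih =>
      refine ih.trans (mass_le_of p hss measurableSet_Ioi ?_)
      intro i hi x hx
      simp only [mem_preimage, mem_Ioi, f] at hx ⊢
      have := (f_le p hi).2
      have h3 : ε * (1 / ρ) ^ (n + 1) * ρ = ε * (1 / ρ) ^ n := by rw [pow_succ]; field_simp
      nlinarith
  have h2 : Tendsto (fun n : ℕ => 1 + (ε * (1 / ρ) ^ n)) atTop atTop := by
    apply tendsto_atTop_add_const_left
    apply Tendsto.const_mul_atTop hε
    apply tendsto_pow_atTop_atTop_of_one_lt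
    rw [lt_div_iff₀ hρ]; linarith [p.quarter]
  exact le_antisymm (ge_of_tendsto' (tendsto_real_Ioi.comp h2) h1) measureReal_nonneg

lemma mass_Iio (p : Par N ρ) [IsProbabilityMeasure μ] (hss : IsSelfSimilar N ρ μ) :
    μ (Iio 0) = 0 := by
  have h : Iio (0:ℝ) ⊆ ⋃ n : ℕ, Iic (-(1 / ((n : ℝ) + 1))) := by
    intro x hx
    obtain ⟨n, hn⟩ := exists_nat_one_div_lt (show 0 < -x by simpa using hx)
    exact mem_iUnion.2 ⟨n, by simp only [mem_Iic]; linarith⟩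
  refine measure_mono_null h (measure_iUnion_null fun n => ?_)
  exact (measureReal_eq_zero_iff).1 (mass_neg p hss (by positivity))

lemma mass_Ioi (p : Par N ρ) [IsProbabilityMeasure μ] (hss : IsSelfSimilar N ρ μ) :
    μ (Ioi 1) = 0 := by
  have h : Ioi (1:ℝ) ⊆ ⋃ n : ℕ, Ioi (1 + (1 / ((n : ℝ) + 1))) := by
    intro x hx
    obtain ⟨n, hn⟩ := exists_nat_one_div_lt (show 0 < x - 1 by simpa using hx)
    exact mem_iUnion.2 ⟨n, by simp only [mem_Ioi]; linarith⟩
  refine measure_mono_null h (measure_iUnion_null fun n => ?_)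
  exact (measureReal_eq_zero_iff).1 (mass_pos p hss (by positivity))

lemma mass_Icc (p : Par N ρ) [IsProbabilityMeasure μ] (hss : IsSelfSimilar N ρ μ) {A : Set ℝ}
    (h : Icc 0 1 ⊆ A) : μ.real A = 1 := by
  have h1 : μ (Icc (0:ℝ) 1)ᶜ = 0 := by
    refine measure_mono_null ?_ (measure_union_null (mass_Iio p hss) (mass_Ioi p hss))
    intro x hx
    by_contra h2
    simp only [mem_union, mem_Iio, mem_Ioi, not_or, not_lt] at h2
    exact hx ⟨h2.1, h2.2⟩
  have h2 : μ Aᶜ = 0 := measure_mono_null (compl_subset_compl.2 h) h1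
  unfold Measure.real
  rw [prob_compl_eq_zero_iff₀ (NullMeasurableSet.of_compl (NullMeasurableSet.of_null h2))] at h2
  simp [h2]

lemma mass_zero (p : Par N ρ) [IsProbabilityMeasure μ] (hss : IsSelfSimilar N ρ μ) {A : Set ℝ}
    (h : ∀ x ∈ A, x < 0 ∨ 1 < x) : μ.real A = 0 := by
  rw [measureReal_eq_zero_iff]
  exact measure_mono_null (fun x hx => h x hx) (measure_union_null (mass_Iio p hss) (mass_Ioi p hss))

/-- one-sided growth at the right end -/
lemma end_right (p : Par N ρ) [IsProbabilityMeasure μ] (hss : IsSelfSimilar N ρ μ) (m : ℕ) :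
    ∀ u : ℝ, ρ ^ m < u → 1 ≤ (N:ℝ) ^ m * μ.real (Ioi (1 - u)) := by
  have hN := p.N2
  have hρ := p.h0
  induction m with
  | zero =>
    intro u hu
    rw [mass_Icc p hss]
    · simp
    · rintro x ⟨hx, -⟩; simp at hu ⊢; linarith
  | succ m ih =>
    intro u hu
    have h1 := mass p hss (A := Ioi (1 - u)) measurableSet_Ioi
    have h2 := ih (u / ρ) (by rwa [lt_div_iff₀ hρ, ← pow_succ])
    have h3 : μ.real (Ioi (1 - u / ρ)) ≤ ∑ i ∈ Finset.range N, μ.real (f N ρ i ⁻¹' Ioi (1 - u)) := by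
      refine le_trans (measureReal_mono ?_) (Finset.single_le_sum
        (f := fun i => μ.real (f N ρ i ⁻¹' Ioi (1 - u)))
        (fun i _ => measureReal_nonneg) (Finset.mem_range.2 (show N - 1 < N by have := p.hN; omega)))
      intro x hx
      simp only [mem_preimage, mem_Ioi, f] at hx ⊢
      rw [Nat.cast_sub (by have := p.hN; omega), Nat.cast_one, p.R_eq]
      have : u / ρ * ρ = u := by field_simp
      nlinarith
    rw [pow_succ, mul_assoc, h1]
    exact h2.trans (by gcongr)

lemma end_left (p : Par N ρ) [IsProbabilityMeasure μ] (hss : IsSelfSimilar N ρ μ) (m : ℕ) :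
    ∀ u : ℝ, ρ ^ m < u → 1 ≤ (N:ℝ) ^ m * μ.real (Iio u) := by
  have hN := p.N2
  have hρ := p.h0
  induction m with
  | zero =>
    intro u hu
    rw [mass_Icc p hss]
    · simp
    · rintro x ⟨-, hx⟩; simp at hu ⊢; linarith
  | succ m ih =>
    intro u hu
    have h1 := mass p hss (A := Iio u) measurableSet_Iio
    have h2 := ih (u / ρ) (by rwa [lt_div_iff₀ hρ, ← pow_succ])
    have h3 : μ.real (Iio (u / ρ)) ≤ ∑ i ∈ Finset.range N, μ.real (f N ρ i ⁻¹' Iio u) := by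
      refine le_trans (measureReal_mono ?_) (Finset.single_le_sum
        (f := fun i => μ.real (f N ρ i ⁻¹' Iio u))
        (fun i _ => measureReal_nonneg) (Finset.mem_range.2 (show 0 < N by have := p.hN; omega)))
      intro x hx
      simp only [mem_preimage, mem_Iio, f] at hx ⊢
      have : u / ρ * ρ = u := by field_simp
      simp only [Nat.cast_zero, zero_mul, add_zero]
      nlinarith
    rw [pow_succ, mul_assoc, h1]
    exact h2.trans (by gcongr)

lemma end_aux (p : Par N ρ) (F : ℝ → ℝ) (hF : ∀ (m : ℕ) (u : ℝ), ρ ^ m < u → 1 ≤ (N:ℝ) ^ m * F u)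
    {u : ℝ} (h0 : 0 < u) (h2 : u ≤ 2) : u / N ≤ F u := by
  have hN := p.N2
  have hρ := p.h0
  rw [div_le_iff₀ (by linarith)]
  by_cases h1 : 1 < u
  · have := hF 0 u (by simpa using h1)
    simp at this
    nlinarith
  push Not at h1
  obtain ⟨m, hm1, hm2⟩ := exists_nat_pow_near_of_lt_one h0 h1 hρ (by linarith [p.quarter])
  have h3 := hF (m + 1) u hm1
  have h4 : (N : ℝ) ^ m * ρ ^ m ≤ 1 := by
    rw [← mul_pow]; exact pow_le_one₀ (by positivity) (by linarith [p.N_rho])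
  have hNm : (0:ℝ) < N ^ m := by positivity
  have h5 : (N:ℝ) ^ m * u ≤ N ^ m * (F u * N) := by
    calc (N:ℝ) ^ m * u ≤ N ^ m * ρ ^ m := by gcongr
      _ ≤ 1 := h4
      _ ≤ _ := h3
      _ = _ := by rw [pow_succ]; ring
  exact le_of_mul_le_mul_left h5 hNm


end

section
variable {N : ℕ} {ρ : ℝ} {μ : Measure ℝ}

/-- mass of an open ball -/
noncomputable def bm (μ : Measure ℝ) (y r : ℝ) : ℝ := μ.real (Ioo (y - r) (y + r))

lemma ball_mass (p : Par N ρ) [IsProbabilityMeasure μ] (hss : IsSelfSimilar N ρ μ) (t v : ℝ) (j : ℕ) :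
    (N : ℝ) * bm μ (ρ * t + j * R N ρ) (ρ * v) =
      ∑ i ∈ Finset.range N, bm μ (t + ((j:ℝ) - i) * (R N ρ / ρ)) v := by
  unfold bm
  rw [mass p hss measurableSet_Ioo]
  refine Finset.sum_congr rfl fun i _ => ?_
  congr 1
  have hρ := p.h0
  ext x
  simp only [mem_preimage, mem_Ioo, f]
  have e : ((j:ℝ) - i) * (R N ρ / ρ) * ρ = (j - i) * R N ρ := by field_simp
  set E := ((j:ℝ) - i) * (R N ρ / ρ)
  constructor
  · rintro ⟨h1, h2⟩
    constructor
    · by_contra h; push Not at h; nlinarith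
    · by_contra h; push Not at h; nlinarith
  · rintro ⟨h1, h2⟩
    constructor <;> nlinarith

lemma bm_nonneg (y r : ℝ) : 0 ≤ bm μ y r := measureReal_nonneg

lemma bm_le_one [IsProbabilityMeasure μ] (y r : ℝ) : bm μ y r ≤ 1 := measureReal_le_one

lemma bm_one (p : Par N ρ) [IsProbabilityMeasure μ] (hss : IsSelfSimilar N ρ μ) {y r : ℝ}
    (h1 : y - r < 0) (h2 : 1 < y + r) : bm μ y r = 1 :=
  mass_Icc p hss fun _ hx => ⟨h1.trans_le hx.1, hx.2.trans_lt h2⟩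

lemma ball_ge (p : Par N ρ) [IsProbabilityMeasure μ] (hss : IsSelfSimilar N ρ μ) (t v : ℝ) {j : ℕ}
    (hj : j < N) : bm μ t v ≤ (N : ℝ) * bm μ (ρ * t + j * R N ρ) (ρ * v) := by
  rw [ball_mass p hss]
  have := Finset.single_le_sum (f := fun i : ℕ => bm μ (t + ((j:ℝ) - i) * (R N ρ / ρ)) v)
    (fun i _ => bm_nonneg _ _) (Finset.mem_range.2 hj)
  simpa using this

lemma B0_ge (p : Par N ρ) : (N : ℝ) + 1 ≤ R N ρ / ρ := by
  rw [le_div_iff₀ p.h0]; exact p.R_ge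

lemma ball_iso (p : Par N ρ) [IsProbabilityMeasure μ] (hss : IsSelfSimilar N ρ μ) (t v : ℝ) {j : ℕ}
    (hj : j < N) (h1 : 0 < j → 1 ≤ t + R N ρ / ρ - v) (h2 : j < N - 1 → t - R N ρ / ρ + v ≤ 0) :
    (N : ℝ) * bm μ (ρ * t + j * R N ρ) (ρ * v) = bm μ t v := by
  rw [ball_mass p hss, Finset.sum_eq_single_of_mem j (Finset.mem_range.2 hj)]
  · simp
  · intro i hi hij
    have hB := B0_ge p
    have hN := p.N2
    set B := R N ρ / ρ
    apply mass_zero p hss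
    intro x hx
    rcases lt_or_gt_of_ne hij with h | h
    · right
      have h3 : (i:ℝ) + 1 ≤ j := by exact_mod_cast h
      have := h1 (by omega)
      have := hx.1
      nlinarith
    · left
      have h3 : (j:ℝ) + 1 ≤ i := by exact_mod_cast h
      have := h2 (by have := Finset.mem_range.1 hi; omega)
      have := hx.2
      nlinarith

/-! ### coding -/

lemma summable_dig (p : Par N ρ) {d : ℕ → ℕ} (hd : ∀ i, d i < N) :
    Summable (fun i => (d i : ℝ) * ρ ^ i) := by
  have h1 : ρ < 1 := by linarith [p.quarter]
  refine Summable.of_nonneg_of_le (fun i => by have := p.h0; positivity) (fun i => ?_)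
    ((summable_geometric_of_lt_one p.h0.le h1).mul_left (N : ℝ))
  have : (d i : ℝ) ≤ N := by exact_mod_cast (hd i).le
  have := p.h0
  gcongr

lemma piMap_succ (p : Par N ρ) {d : ℕ → ℕ} (hd : ∀ i, d i < N) :
    piMap N ρ d = ρ * piMap N ρ (fun i => d (i + 1)) + d 0 * R N ρ := by
  unfold piMap
  rw [(summable_dig p hd).tsum_eq_zero_add]
  have : ∑' i, (d (i + 1) : ℝ) * ρ ^ (i + 1) = ρ * ∑' i, (d (i + 1) : ℝ) * ρ ^ i := by
    rw [← tsum_mul_left]; apply tsum_congr; intro i; ring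
  rw [this]; simp; ring

lemma piMap_nonneg (p : Par N ρ) (d : ℕ → ℕ) : 0 ≤ piMap N ρ d := by
  unfold piMap
  have := p.h0
  exact mul_nonneg p.R_pos.le (tsum_nonneg fun i => by positivity)

lemma piMap_refl (p : Par N ρ) {d d' : ℕ → ℕ} (hd : ∀ i, d i < N) (hd' : ∀ i, d' i + d i = N - 1) :
    piMap N ρ d' = 1 - piMap N ρ d := by
  have h1 : ρ < 1 := by linarith [p.quarter]
  have hd'' : ∀ i, d' i < N := fun i => by have := hd' i; have := p.hN; omega
  have h2 : ∑' i, (d i : ℝ) * ρ ^ i + ∑' i, (d' i : ℝ) * ρ ^ i = ((N:ℝ) - 1) * (1 - ρ)⁻¹ := by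
    rw [← (summable_dig p hd).tsum_add (summable_dig p hd''), ← tsum_geometric_of_lt_one p.h0.le h1,
      ← tsum_mul_left]
    apply tsum_congr
    intro i
    have h3 : (d' i : ℝ) + d i = N - 1 := by
      have h4 : d' i + d i + 1 = N := by have := hd' i; have := p.hN; omega
      have h5 : (d' i : ℝ) + d i + 1 = N := by exact_mod_cast h4
      linarith
    rw [← h3]; ring
  unfold piMap
  have h3 := p.R_eq
  have h4 : R N ρ * (((N:ℝ) - 1) * (1 - ρ)⁻¹) = 1 := by
    rw [← mul_assoc, mul_comm (R N ρ), h3, mul_inv_cancel₀ (by linarith)]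
  rw [← h2] at h4
  linarith

lemma piMap_le_one (p : Par N ρ) {d : ℕ → ℕ} (hd : ∀ i, d i < N) : piMap N ρ d ≤ 1 := by
  have := piMap_refl p hd (d' := fun i => N - 1 - d i) (fun i => by have := hd i; omega)
  have := piMap_nonneg p (fun i => N - 1 - d i)
  linarith

lemma Tn_succ (p : Par N ρ) {d : ℕ → ℕ} (hd : ∀ i, d i < N) (n : ℕ) :
    Tn N ρ d n = ρ * Tn N ρ d (n + 1) + d n * R N ρ := by
  unfold Tn
  rw [piMap_succ p (fun i => hd _)]
  simp only [add_zero]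
  congr 3
  funext i; congr 1; ring

lemma Tn_shift (d : ℕ → ℕ) (n : ℕ) : Tn N ρ (fun i => d (i + 1)) n = Tn N ρ d (n + 1) := by
  unfold Tn; congr 1; funext i; show d (n + i + 1) = d (n + 1 + i); rw [Nat.add_right_comm]

lemma Tn_zero (d : ℕ → ℕ) : Tn N ρ d 0 = piMap N ρ d := by
  unfold Tn; simp

lemma ball_upper (p : Par N ρ) [IsProbabilityMeasure μ] (hss : IsSelfSimilar N ρ μ) {τ : ℝ}
    (h0 : 0 ≤ τ) (h1 : τ ≤ 1) (n : ℕ) : ∀ {d : ℕ → ℕ} (_ : ∀ i, d i < N)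
    (_ : d n ≠ 0 → τ ≤ Tn N ρ d (n + 1)) (_ : d n ≠ N - 1 → τ ≤ 1 - Tn N ρ d (n + 1)),
    (N : ℝ) ^ (n + 1) * bm μ (piMap N ρ d) (ρ ^ (n + 1) * (R N ρ / ρ - 1 + τ)) ≤ 1 := by
  have hB := B0_ge p
  have hN := p.N2
  have hρ := p.h0
  induction n with
  | zero =>
    intro d hd hl hr
    have := ball_iso p hss (Tn N ρ d 1) (R N ρ / ρ - 1 + τ) (hd 0)
      (fun h => by have := hl (by omega); simp only [zero_add] at this; linarith)
      (fun h => by have := hr (by omega); simp only [zero_add] at this; linarith)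
    rw [← Tn_succ p hd 0, Tn_zero] at this
    simp only [zero_add, pow_one]
    rw [this]
    exact bm_le_one _ _
  | succ n ih =>
    intro d hd hl hr
    have hT0 := piMap_nonneg p (fun i => d (i + 1))
    have hT1 := piMap_le_one p (d := fun i => d (i + 1)) (fun i => hd _)
    set v := ρ ^ (n + 1) * (R N ρ / ρ - 1 + τ) with hv
    have hv1 : v ≤ R N ρ / ρ - 1 := by
      have h3 : ρ ^ (n + 1) ≤ ρ := by
        rw [pow_succ]; exact mul_le_of_le_one_left hρ.le (pow_le_one₀ hρ.le (by linarith [p.quarter]))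
      have h4 : v ≤ ρ * (R N ρ / ρ) := by
        rw [hv]; apply mul_le_mul h3 _ _ hρ.le <;> linarith
      have := p.quarter
      nlinarith
    have := ball_iso p hss (piMap N ρ (fun i => d (i + 1))) v (hd 0)
      (fun h => by linarith) (fun h => by linarith)
    rw [← piMap_succ p hd] at this
    have e : ρ ^ (n + 1 + 1) * (R N ρ / ρ - 1 + τ) = ρ * v := by rw [hv, pow_succ ρ (n + 1)]; ring
    rw [e, pow_succ, mul_assoc, this]
    refine ih (fun i => hd _) ?_ ?_
    · rw [Tn_shift]; exact hl
    · rw [Tn_shift]; exact hr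

lemma ball_chain (p : Par N ρ) [IsProbabilityMeasure μ] (hss : IsSelfSimilar N ρ μ) (n : ℕ) :
    ∀ {d : ℕ → ℕ} (_ : ∀ i, d i < N) (r : ℝ),
    bm μ (Tn N ρ d n) r ≤ (N : ℝ) ^ n * bm μ (piMap N ρ d) (ρ ^ n * r) := by
  induction n with
  | zero => intro d hd r; simp [Tn_zero]
  | succ n ih =>
    intro d hd r
    have h1 := ih (d := fun i => d (i + 1)) (fun i => hd _) r
    rw [Tn_shift] at h1
    have h2 := ball_ge p hss (piMap N ρ (fun i => d (i + 1))) (ρ ^ n * r) (hd 0)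
    rw [← piMap_succ p hd] at h2
    refine h1.trans ?_
    rw [pow_succ, pow_succ', mul_assoc, mul_assoc]
    gcongr

lemma rpow_aux {s v β k : ℝ} (hs1 : s ≤ 1 / 2) (hs0 : 0 < s) (hβ : 0 < β) (hv : 0 < v) (hk : 1 ≤ k)
    (h : v ≤ k ^ 2 * β) : (v / β) ^ s ≤ k := by
  calc (v / β) ^ s ≤ (k ^ 2) ^ s := by
        apply Real.rpow_le_rpow (by positivity) _ hs0.le
        rw [div_le_iff₀ hβ]; exact h
    _ = k ^ (2 * s) := by
        rw [← Real.rpow_natCast, ← Real.rpow_mul (by linarith)]; norm_num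
    _ ≤ k ^ (1:ℝ) := Real.rpow_le_rpow_of_exponent_le hk (by linarith)
    _ = k := Real.rpow_one k

lemma one_level (p : Par N ρ) [IsProbabilityMeasure μ] (hss : IsSelfSimilar N ρ μ) {τ s t v : ℝ} {j : ℕ}
    (hτ : 0 ≤ τ) (hs0 : 0 < s) (hs1 : s ≤ 1 / 2) (ht0 : 0 ≤ t) (ht1 : t ≤ 1) (hj : j < N)
    (hc : (j ≠ 0 ∧ t ≤ τ) ∨ (j ≠ N - 1 ∧ 1 - t ≤ τ)) (hv : 1 < v) (hv' : v ≤ 1 / ρ) :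
    (v / (R N ρ / ρ - 1 + τ)) ^ s ≤ N * bm μ (ρ * t + j * R N ρ) (ρ * v) := by
  have hB := B0_ge p
  have hN := p.N2
  have hρ := p.h0
  rw [ball_mass p hss]
  have hRB : ((N:ℝ) - 1) * (R N ρ / ρ) + 1 = 1 / ρ := by
    have := p.R_eq
    field_simp
    linarith
  set B := R N ρ / ρ with hBdef
  set β := B - 1 + τ with hβ
  have hβN : (N:ℝ) ≤ β := by linarith
  have hβ0 : 0 < β := by linarith
  set F : ℕ → ℝ := fun i => bm μ (t + ((j:ℝ) - i) * B) v with hF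
  have hF0 : ∀ i, 0 ≤ F i := fun i => bm_nonneg _ _
  have hFj : F j = 1 := by
    apply bm_one p hss <;> simp <;> linarith
  show _ ≤ ∑ i ∈ Finset.range N, F i
  by_cases c1 : v ≤ β
  · have h1 : F j ≤ ∑ i ∈ Finset.range N, F i :=
      Finset.single_le_sum (fun i _ => hF0 i) (Finset.mem_range.2 hj)
    refine le_trans ?_ (hFj ▸ h1)
    exact rpow_aux hs1 hs0 hβ0 (by linarith) le_rfl (by linarith)
  push Not at c1
  by_cases c2 : v ≤ B + 1
  · have hu0 : 0 < v - β := by linarith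
    have hu2 : v - β ≤ 2 := by linarith
    have key : ∃ i, i < N ∧ i ≠ j ∧ (v - β) / N ≤ F i := by
      rcases hc with ⟨h1, h2⟩ | ⟨h1, h2⟩
      · refine ⟨j - 1, by omega, by omega, ?_⟩
        have e : ((j - 1 : ℕ) : ℝ) = (j:ℝ) - 1 := by
          rw [Nat.cast_sub (by omega), Nat.cast_one]
        have h3 := end_aux p (fun u => μ.real (Ioi (1 - u))) (end_right p hss) hu0 hu2
        refine h3.trans ?_
        have h4 : μ.real (Ioi (1 - (v - β))) ≤ μ.real (Ioc (1 - (v - β)) 1) + μ.real (Ioi 1) := by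
          refine le_trans (measureReal_mono ?_) (measureReal_union_le _ _)
          intro x hx
          by_cases hx1 : x ≤ 1
          · exact Or.inl ⟨hx, hx1⟩
          · exact Or.inr (not_le.1 hx1)
        rw [mass_zero p hss (A := Ioi 1) (fun x hx => Or.inr hx), add_zero] at h4
        refine h4.trans (measureReal_mono ?_)
        intro x hx
        rw [e]
        constructor
        · have := hx.1; linarith
        · have := hx.2; linarith
      · refine ⟨j + 1, by omega, by omega, ?_⟩
        have h3 := end_aux p (fun u => μ.real (Iio u)) (end_left p hss) hu0 hu2
        refine h3.trans ?_
        have h4 : μ.real (Iio (v - β)) ≤ μ.real (Ico 0 (v - β)) + μ.real (Iio 0) := by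
          refine le_trans (measureReal_mono ?_) (measureReal_union_le _ _)
          intro x hx
          by_cases hx1 : 0 ≤ x
          · exact Or.inl ⟨hx1, hx⟩
          · exact Or.inr (not_le.1 hx1)
        rw [mass_zero p hss (A := Iio 0) (fun x hx => Or.inl hx), add_zero] at h4
        refine h4.trans (measureReal_mono ?_)
        intro x hx
        push_cast
        constructor
        · have := hx.1; linarith
        · have := hx.2; linarith
    obtain ⟨i, hi, hij, hFi⟩ := key
    have h1 : F i + F j ≤ ∑ i ∈ Finset.range N, F i := by
      rw [← Finset.sum_pair hij]
      apply Finset.sum_le_sum_of_subset_of_nonneg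
      · intro a ha
        simp only [Finset.mem_insert, Finset.mem_singleton] at ha
        rw [Finset.mem_range]
        rcases ha with rfl | rfl <;> assumption
      · intro a _ _; exact hF0 a
    refine le_trans ?_ h1
    have h2 : (v / β) ^ s ≤ 1 + s * ((v - β) / β) := by
      have h3 := rpow_one_add_le_one_add_mul_self (s := (v - β) / β)
        (by have : 0 ≤ (v - β) / β := by positivity
            linarith) hs0.le (by linarith : s ≤ 1)
      rwa [show 1 + (v - β) / β = v / β by field_simp; ring] at h3
    have h3 : s * ((v - β) / β) ≤ (v - β) / N := by
      calc s * ((v - β) / β) ≤ 1 * ((v - β) / N) := by gcongr; linarith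
        _ = _ := one_mul _
    linarith
  push Not at c2
  -- `k` full cells
  have hB0 : 0 < B := by linarith
  obtain ⟨k, hk1, hk2⟩ : ∃ k : ℕ, (k:ℝ) * B + 1 < v ∧ v ≤ ((k:ℝ) + 1) * B + 1 := by
    set K := ⌈(v - 1) / B⌉₊ with hK
    have h1 : (v - 1) / B ≤ K := Nat.le_ceil _
    have h2 : (K:ℝ) < (v - 1) / B + 1 := Nat.ceil_lt_add_one (by apply div_nonneg <;> linarith)
    have h3 : 0 < K := by rw [hK, Nat.ceil_pos]; apply div_pos <;> linarith
    rw [div_le_iff₀ hB0] at h1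
    have h4 : ((K:ℝ) - 1) < (v - 1) / B := by linarith
    rw [lt_div_iff₀ hB0] at h4
    refine ⟨K - 1, ?_, ?_⟩
    · rw [Nat.cast_sub h3, Nat.cast_one]; linarith
    · rw [Nat.cast_sub h3, Nat.cast_one]; linarith
  have hk0 : 1 ≤ k := by
    by_contra h
    have : k = 0 := by omega
    subst this
    simp at hk2; linarith
  have hkN : k + 2 ≤ N := by
    have h1 : (k:ℝ) * B < ((N:ℝ) - 1) * B := by linarith
    have h2 : (k:ℝ) < (N:ℝ) - 1 := lt_of_mul_lt_mul_right h1 hB0.le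
    have h3 : (k:ℝ) + 1 < N := by linarith
    have h4 : k + 1 < N := by exact_mod_cast h3
    omega
  have hfull : ∀ i, i ≤ j + k → j ≤ i + k → F i = 1 := by
    intro i h1 h2
    have h1' : (i:ℝ) ≤ j + k := by exact_mod_cast h1
    have h2' : (j:ℝ) ≤ i + k := by exact_mod_cast h2
    apply bm_one p hss
    · nlinarith
    · nlinarith
  have hcount : ((k:ℝ) + 1) ≤ ∑ i ∈ Finset.range N, F i := by
    have hex : ∃ a, a + k < N ∧ a ≤ j ∧ j ≤ a + k := by
      by_cases h : j + k < N
      · exact ⟨j, h, le_rfl, by omega⟩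
      · exact ⟨N - 1 - k, by omega, by omega, by omega⟩
    obtain ⟨a, ha1, ha2, ha3⟩ := hex
    calc (k:ℝ) + 1 = ∑ i ∈ Finset.Icc a (a + k), F i := by
          rw [Finset.sum_congr rfl (g := fun _ => (1:ℝ))]
          · simp
            rw [show a + k + 1 - a = k + 1 by omega]; push_cast; ring
          · intro i hi
            rw [Finset.mem_Icc] at hi
            exact hfull i (by omega) (by omega)
      _ ≤ _ := by
          apply Finset.sum_le_sum_of_subset_of_nonneg
          · intro i hi
            rw [Finset.mem_Icc] at hi
            rw [Finset.mem_range]; omega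
          · intro a _ _; exact hF0 a
  refine le_trans ?_ hcount
  have hk0' : (1:ℝ) ≤ k := by exact_mod_cast hk0
  refine rpow_aux hs1 hs0 hβ0 (by linarith) (by linarith) ?_
  have : ((k:ℝ) + 1) ^ 2 * (B - 1) ≤ ((k:ℝ) + 1) ^ 2 * β := by gcongr; linarith
  nlinarith


end

section
variable {N : ℕ} {ρ : ℝ} {μ : Measure ℝ}

lemma s_facts (p : Par N ρ) {s : ℝ} (hs : s = -Real.log N / Real.log ρ) :
    0 < s ∧ s ≤ 1 / 2 ∧ ρ ^ s * N = 1 := by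
  have hN := p.N2
  have hρ := p.h0
  have hq := p.quarter
  have hlN : 0 < Real.log N := Real.log_pos (by linarith)
  have hlρ : Real.log ρ + 2 * Real.log N ≤ 0 := by
    have h1 := Real.log_le_log (by positivity) p.h1
    rw [Real.log_mul hρ.ne' (by positivity), Real.log_pow, Real.log_one] at h1
    exact_mod_cast h1
  have hlρ0 : Real.log ρ < 0 := by linarith
  have hmul : s * Real.log ρ = - Real.log N := by rw [hs, div_mul_cancel₀ _ hlρ0.ne]
  refine ⟨?_, ?_, ?_⟩
  · rw [hs]; exact div_pos_of_neg_of_neg (by linarith) hlρ0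
  · rw [hs, div_le_iff_of_neg hlρ0]; linarith
  · rw [Real.rpow_def_of_pos hρ, mul_comm, mul_comm (Real.log ρ), hmul, Real.exp_neg,
      Real.exp_log (by linarith)]
    field_simp

lemma pow_s (p : Par N ρ) {s : ℝ} (hsN : ρ ^ s * N = 1) (n : ℕ) :
    (ρ ^ n) ^ s * (N : ℝ) ^ n = 1 := by
  have h : (ρ ^ n) ^ s = (ρ ^ s) ^ n := by
    rw [← Real.rpow_natCast, ← Real.rpow_natCast, ← Real.rpow_mul p.h0.le, ← Real.rpow_mul p.h0.le,
      mul_comm]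
  rw [h, ← mul_pow, hsN, one_pow]

/-- `(2 r)^s (2 β)^(-s) = (r / β)^s` -/
lemma rpow_ratio {r β s : ℝ} (hr : 0 < r) (hβ : 0 < β) :
    (2 * β) ^ (-s) * (2 * r) ^ s = (r / β) ^ s := by
  rw [Real.rpow_neg (by positivity), Real.div_rpow hr.le hβ.le, Real.mul_rpow (by norm_num) hr.le,
    Real.mul_rpow (by norm_num) hβ.le]
  have : (0:ℝ) < 2 ^ s := by positivity
  have : 0 < β ^ s := by positivity
  field_simp

lemma beta_pos (p : Par N ρ) {τ : ℝ} (hτ : 0 ≤ τ) : 0 < R N ρ / ρ - 1 + τ := by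
  have := B0_ge p; have := p.N2; linarith

/-- ratio at the bad radii -/
lemma ratio_le (p : Par N ρ) [IsProbabilityMeasure μ] (hss : IsSelfSimilar N ρ μ) {τ s : ℝ}
    (hsN : ρ ^ s * N = 1)
    (h0 : 0 ≤ τ) (h1 : τ ≤ 1) (n : ℕ) {d : ℕ → ℕ} (hd : ∀ i, d i < N)
    (ha : d n ≠ 0 → τ ≤ Tn N ρ d (n + 1)) (hb : d n ≠ N - 1 → τ ≤ 1 - Tn N ρ d (n + 1)) :
    bm μ (piMap N ρ d) (ρ ^ (n + 1) * (R N ρ / ρ - 1 + τ)) /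
      (2 * (ρ ^ (n + 1) * (R N ρ / ρ - 1 + τ))) ^ s ≤ (2 * (R N ρ / ρ - 1 + τ)) ^ (-s) := by
  have hρ := p.h0
  have hβ := beta_pos p h0
  have h := ball_upper p hss h0 h1 n hd ha hb
  set β := R N ρ / ρ - 1 + τ
  have hr : 0 < ρ ^ (n + 1) * β := by positivity
  rw [div_le_iff₀ (by positivity), rpow_ratio hr hβ, mul_div_cancel_right₀ _ hβ.ne']
  have h2 := pow_s p hsN (n + 1)
  have h3 : 0 < (ρ ^ (n + 1)) ^ s := by positivity
  have h4 := mul_le_mul_of_nonneg_left h h3.le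
  rw [← mul_assoc, h2] at h4
  linarith

lemma radii_tendsto (p : Par N ρ) {β : ℝ} (hβ : 0 < β) :
    Tendsto (fun n : ℕ => ρ ^ (n + 1) * β) atTop (𝓝[>] 0) := by
  have hρ := p.h0
  rw [tendsto_nhdsWithin_iff]
  constructor
  · have h := (tendsto_pow_atTop_nhds_zero_of_lt_one hρ.le
      (by linarith [p.quarter] : ρ < 1)).comp (tendsto_add_atTop_nat 1)
    have := h.mul_const β
    simpa using this
  · filter_upwards with n
    have : 0 < ρ ^ (n + 1) * β := by positivity
    exact this

lemma dens_ge (p : Par N ρ) [IsProbabilityMeasure μ] (hss : IsSelfSimilar N ρ μ) {τ s : ℝ}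
    (hs0 : 0 < s) (hs1 : s ≤ 1 / 2) (hsN : ρ ^ s * N = 1) {d : ℕ → ℕ} (hd : ∀ i, d i < N)
    (hτ : 0 ≤ τ) (n0 : ℕ) (hc : ∀ n, n0 ≤ n → (d n ≠ 0 ∧ Tn N ρ d (n + 1) ≤ τ) ∨
      (d n ≠ N - 1 ∧ 1 - Tn N ρ d (n + 1) ≤ τ)) :
    (2 * (R N ρ / ρ - 1 + τ)) ^ (-s) ≤ lowerDensity μ s (piMap N ρ d) := by
  have hρ := p.h0
  have hρ1 : ρ < 1 := by linarith [p.quarter]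
  have hβ := beta_pos p hτ
  unfold lowerDensity
  have hT0 : ∀ n, 0 ≤ Tn N ρ d n := fun n => piMap_nonneg p _
  have hT1 : ∀ n, Tn N ρ d n ≤ 1 := fun n => piMap_le_one p fun i => hd _
  apply le_liminf_of_le
  · have hβ0 := beta_pos p (le_refl 0)
    refine IsCoboundedUnder.of_frequently_le (a := (2 * (R N ρ / ρ - 1 + 0)) ^ (-s)) ?_
    refine (radii_tendsto p hβ0).frequently (Frequently.of_forall fun n => ?_)
    exact ratio_le p hss hsN le_rfl zero_le_one n hd (fun _ => hT0 _) (fun _ => by linarith [hT1 (n+1)])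
  · have h1 : ∀ᶠ r in 𝓝[>] (0:ℝ), r < ρ ^ n0 :=
      (eventually_lt_nhds (by positivity : (0:ℝ) < ρ ^ n0)).filter_mono nhdsWithin_le_nhds
    filter_upwards [h1, self_mem_nhdsWithin] with r hr hr0
    replace hr0 : 0 < r := hr0
    obtain ⟨n, hn1, hn2⟩ := exists_nat_pow_near_of_lt_one hr0
      (hr.le.trans (pow_le_one₀ hρ.le hρ1.le)) hρ hρ1
    have hn : n0 ≤ n := by
      by_contra hlt
      have : ρ ^ n0 ≤ ρ ^ (n + 1) := pow_le_pow_of_le_one hρ.le hρ1.le (by omega)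
      linarith
    have hpn : 0 < ρ ^ n := by positivity
    have hv1 : 1 < r / ρ ^ (n + 1) := by rw [lt_div_iff₀ (by positivity)]; linarith
    have hv2 : r / ρ ^ (n + 1) ≤ 1 / ρ := by
      rw [div_le_div_iff₀ (by positivity) hρ, pow_succ]; nlinarith
    have h2 := one_level p hss hτ hs0 hs1 (hT0 (n+1)) (hT1 (n+1)) (hd n) (hc n hn) hv1 hv2
    rw [← Tn_succ p hd] at h2
    have h3 := ball_chain p hss n hd (ρ * (r / ρ ^ (n + 1)))
    have e1 : ρ ^ n * (ρ * (r / ρ ^ (n + 1))) = r := by rw [pow_succ]; field_simp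
    rw [e1] at h3
    set β := R N ρ / ρ - 1 + τ
    have e2 : (r / ρ ^ (n + 1) / β) ^ s = (r / β) ^ s * (N : ℝ) ^ (n + 1) := by
      have := pow_s p hsN (n + 1)
      rw [show r / ρ ^ (n + 1) / β = (r / β) / ρ ^ (n + 1) by ring,
        Real.div_rpow (by positivity) (by positivity), div_eq_iff (by positivity), mul_assoc,
        mul_comm _ ((ρ ^ (n+1)) ^ s), this, mul_one]
    rw [e2] at h2
    have hN0 : (0:ℝ) < N := by linarith [p.N2]
    have h4 : (r / β) ^ s * (N : ℝ) ^ (n + 1) ≤ bm μ (piMap N ρ d) r * (N : ℝ) ^ (n + 1) := by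
      calc _ ≤ _ := h2
        _ ≤ N * ((N : ℝ) ^ n * bm μ (piMap N ρ d) r) := by gcongr
        _ = _ := by ring
    have h5 := le_of_mul_le_mul_right h4 (by positivity)
    rw [le_div_iff₀ (by positivity), rpow_ratio hr0 hβ]
    exact h5

lemma dens_le (p : Par N ρ) [IsProbabilityMeasure μ] (hss : IsSelfSimilar N ρ μ) {τ s a : ℝ}
    (hsN : ρ ^ s * N = 1) {d : ℕ → ℕ} (hd : ∀ i, d i < N)
    (hτ : 0 ≤ τ) (hτ1 : τ ≤ 1) (ha : (2 * (R N ρ / ρ - 1 + τ)) ^ (-s) < a)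
    (hl : a ≤ lowerDensity μ s (piMap N ρ d)) :
    ∃ n0, ∀ n, n0 ≤ n → (d n ≠ 0 ∧ Tn N ρ d (n + 1) < τ) ∨
      (d n ≠ N - 1 ∧ 1 - Tn N ρ d (n + 1) < τ) := by
  by_contra hcon
  push Not at hcon
  have hβ := beta_pos p hτ
  have : lowerDensity μ s (piMap N ρ d) ≤ (2 * (R N ρ / ρ - 1 + τ)) ^ (-s) := by
    unfold lowerDensity
    apply liminf_le_of_frequently_le
    · refine (radii_tendsto p hβ).frequently ?_
      rw [frequently_atTop]
      intro n0
      obtain ⟨n, hn, h1, h2⟩ := hcon n0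
      exact ⟨n, hn, ratio_le p hss hsN hτ hτ1 n hd h1 h2⟩
    · refine ⟨0, ?_⟩
      simp only [eventually_map]
      filter_upwards [self_mem_nhdsWithin] with r hr
      have hr0 : 0 < r := hr
      positivity
  linarith

end

section
variable {N : ℕ} {ρ : ℝ} {μ : Measure ℝ}

/-- digit sequence coded by a binary sequence -/
def dig (N : ℕ) (x : ℕ → Bool) (i : ℕ) : ℕ :=
  (if x (i + 1) then 1 else 0) + (if x i then 0 else N - 2)

lemma dig_lt (hN : 2 ≤ N) (x : ℕ → Bool) (i : ℕ) : dig N x i < N := by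
  unfold dig; split_ifs <;> omega

lemma dig_real (hN : 2 ≤ N) (x : ℕ → Bool) (i : ℕ) :
    (dig N x i : ℝ) = ((N:ℝ) - 1) / 2 + (sgn (x (i + 1)) - ((N:ℝ) - 2) * sgn (x i)) / 2 := by
  unfold dig
  cases x (i + 1) <;> cases x i <;> simp [sgn_true, sgn_false, Nat.cast_sub hN] <;> ring

lemma piMap_dig (p : Par N ρ) (x : ℕ → Bool) :
    piMap N ρ (dig N x) = 1 / 2 + R N ρ / 2 *
      ((1 - ((N:ℝ) - 2) * ρ) * val ρ (fun i => x (i + 1)) - ((N:ℝ) - 2) * sgn (x 0)) := by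
  have h1 : ρ < 1 := by linarith [p.quarter]
  have hs1 := summable_val p.h0 h1 x
  have hs2 := summable_val p.h0 h1 (fun i => x (i + 1))
  have hs0 := summable_geometric_of_lt_one p.h0.le h1
  have e : ∑' i, (dig N x i : ℝ) * ρ ^ i = ((N:ℝ) - 1) / 2 * (1 - ρ)⁻¹ +
      (1 / 2 * val ρ (fun i => x (i + 1)) + -((N:ℝ) - 2) / 2 * val ρ x) := by
    unfold val
    rw [← tsum_geometric_of_lt_one p.h0.le h1, ← tsum_mul_left, ← tsum_mul_left, ← tsum_mul_left,
      ← (hs2.mul_left _).tsum_add (hs1.mul_left _),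
      ← (hs0.mul_left _).tsum_add ((hs2.mul_left _).add (hs1.mul_left _))]
    apply tsum_congr
    intro i
    rw [dig_real p.hN]; ring
  unfold piMap
  rw [e, val_succ p.h0 h1 x]
  have h3 := p.R_eq
  have h4 : R N ρ * (((N:ℝ) - 1) * (1 - ρ)⁻¹) = 1 := by
    rw [← mul_assoc, mul_comm (R N ρ), h3, mul_inv_cancel₀ (by linarith)]
  linear_combination h4 / 2

noncomputable def Lf (N : ℕ) (ρ w : ℝ) : ℝ :=
  1 / 2 + R N ρ / 2 * ((1 - ((N:ℝ) - 2) * ρ) * w - ((N:ℝ) - 2))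

lemma kappa_pos (p : Par N ρ) : 0 < 1 - ((N:ℝ) - 2) * ρ := by
  have := p.N_rho; have := p.h0; nlinarith

lemma Lf_strictMono (p : Par N ρ) : StrictMono (Lf N ρ) := by
  intro w w' h
  unfold Lf
  have := mul_lt_mul_of_pos_left h (mul_pos p.R_pos (kappa_pos p))
  nlinarith

lemma Lf_continuous : Continuous (Lf N ρ) := by
  unfold Lf; fun_prop

lemma Tn_dig (p : Par N ρ) (x : ℕ → Bool) (n : ℕ) :
    Tn N ρ (dig N x) n = 1 / 2 + R N ρ / 2 *
      ((1 - ((N:ℝ) - 2) * ρ) * val ρ (fun i => x (n + 1 + i)) - ((N:ℝ) - 2) * sgn (x n)) := by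
  have h := piMap_dig p (fun i => x (n + i))
  have e : (fun i => x (n + (i + 1))) = fun i => x (n + 1 + i) := by
    funext i; congr 1; omega
  simp only [e, add_zero] at h
  exact h

lemma Tn_true (p : Par N ρ) {x : ℕ → Bool} {n : ℕ} (hx : x n = true) :
    Tn N ρ (dig N x) n = Lf N ρ (g ρ x n) := by
  rw [Tn_dig p, g, Lf, hx, sgn_true]; ring

lemma Tn_false (p : Par N ρ) {x : ℕ → Bool} {n : ℕ} (hx : x n = false) :
    1 - Tn N ρ (dig N x) n = Lf N ρ (g ρ x n) := by
  rw [Tn_dig p, g, Lf, hx, sgn_false]; ring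

lemma cond_of_g (p : Par N ρ) {x : ℕ → Bool} {n : ℕ} {τ : ℝ} (h : Lf N ρ (g ρ x (n + 1)) ≤ τ) :
    (dig N x n ≠ 0 ∧ Tn N ρ (dig N x) (n + 1) ≤ τ) ∨
      (dig N x n ≠ N - 1 ∧ 1 - Tn N ρ (dig N x) (n + 1) ≤ τ) := by
  have hN := p.hN
  cases hx : x (n + 1)
  · right
    rw [Tn_false p hx]
    refine ⟨?_, h⟩
    unfold dig; rw [hx]; simp only [Bool.false_eq_true, if_false]
    split_ifs <;> omega
  · left
    rw [Tn_true p hx]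
    refine ⟨?_, h⟩
    unfold dig; rw [hx]; simp

lemma lam_eq (hN : 2 ≤ N) {lam : ℕ → ℕ} (hlam1 : lam 1 = N - 1)
    (hlam2 : ∀ n j : ℕ, 1 ≤ j → j < 2 ^ n → lam (2 ^ n + j) = N - 1 - lam j)
    (hlam3 : ∀ n : ℕ, lam (2 ^ (n + 1)) = N - lam (2 ^ n)) (i : ℕ) :
    1 ≤ i → lam i = dig N tm (i - 1) := by
  induction i using Nat.strong_induction_on with
  | _ i ih =>
    intro hi
    have h1 : 2 ^ Nat.log 2 i ≤ i := Nat.pow_log_le_self 2 (by omega)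
    have h2 : i < 2 ^ (Nat.log 2 i + 1) := Nat.lt_pow_succ_log_self (by norm_num) i
    generalize Nat.log 2 i = n at h1 h2
    obtain ⟨j, rfl⟩ := Nat.exists_eq_add_of_le h1
    have hj : j < 2 ^ n := by rw [pow_succ] at h2; omega
    have hp : 1 ≤ 2 ^ n := Nat.one_le_two_pow
    rcases Nat.eq_zero_or_pos j with rfl | hj0
    · rcases n with _ | m
      · simp [dig, tm_zero, tm_one, hlam1]; omega
      · have hpm : 1 ≤ 2 ^ m := Nat.one_le_two_pow
        have h3 := ih (2 ^ m) (by rw [pow_succ]; omega) hpm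
        have t1 := tm_add m 0 (by omega)
        have t2 := tm_add (m + 1) 0 (by omega)
        have t3 := tm_add m (2 ^ m - 1) (by omega)
        rw [tm_zero, add_zero] at t1 t2
        rw [show 2 ^ m + (2 ^ m - 1) = 2 ^ (m + 1) - 1 by rw [pow_succ]; omega] at t3
        rw [add_zero, hlam3, h3]
        unfold dig
        rw [Nat.sub_add_cancel hpm, Nat.sub_add_cancel hp, t1, t2, t3]
        cases tm (2 ^ m - 1) <;> simp <;> omega
    · rw [hlam2 n j hj0 hj, ih j (by omega) hj0]
      have t1 := tm_add n j hj
      have t2 := tm_add n (j - 1) (by omega)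
      rw [show 2 ^ n + (j - 1) = 2 ^ n + j - 1 by omega] at t2
      unfold dig
      rw [Nat.sub_add_cancel hj0, Nat.sub_add_cancel (by omega), t1, t2]
      cases tm j <;> cases tm (j - 1) <;> simp <;> omega

lemma tau_eq (p : Par N ρ) {lam : ℕ → ℕ} (hlam1 : lam 1 = N - 1)
    (hlam2 : ∀ n j : ℕ, 1 ≤ j → j < 2 ^ n → lam (2 ^ n + j) = N - 1 - lam j)
    (hlam3 : ∀ n : ℕ, lam (2 ^ (n + 1)) = N - lam (2 ^ n)) :
    R N ρ * ∑' i : ℕ, (lam (i + 2) : ℝ) * ρ ^ i = Lf N ρ (W ρ) := by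
  have h1 : Tn N ρ (dig N tm) 1 = Lf N ρ (W ρ) := by
    rw [Tn_true p tm_one, g, tm_one, sgn_true, one_mul, W]
    congr 3
    funext i; congr 1; omega
  rw [← h1, Tn, piMap]
  congr 2
  funext i
  rw [lam_eq p.hN hlam1 hlam2 hlam3 (i + 2) (by omega)]
  congr 3; omega

lemma tau_bounds (p : Par N ρ) : 0 ≤ Lf N ρ (W ρ) ∧ Lf N ρ (W ρ) ≤ 1 ∧
    Lf N ρ (W ρ) ≤ R N ρ * (1 + ρ) := by
  have h1 : Tn N ρ (dig N tm) 1 = Lf N ρ (W ρ) := by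
    rw [Tn_true p tm_one, g, tm_one, sgn_true, one_mul, W]
    congr 3
    funext i; congr 1; omega
  refine ⟨h1 ▸ piMap_nonneg p _, h1 ▸ piMap_le_one p (fun i => dig_lt p.hN _ _), ?_⟩
  have h2 := (Lf_strictMono p).monotone (W_le p.h0 p.quarter)
  refine h2.trans ?_
  unfold Lf
  have h3 := p.R_eq
  have h4 := p.R_pos
  have h5 := p.R_ge
  have h6 := p.h0
  have h7 := p.quarter
  have h8 := p.N_rho
  have h9 := p.N2
  nlinarith [mul_pos h4 h6]

lemma Tn_lt (p : Par N ρ) {d : ℕ → ℕ} (hd : ∀ i, d i < N) {k : ℕ} {τ : ℝ}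
    (hτ : τ ≤ R N ρ * (1 + ρ)) (h : Tn N ρ d k < τ) : d k = 0 ∨ (d k = 1 ∧ d (k + 1) = 0) := by
  have h1 := Tn_succ p hd k
  have h2 := Tn_succ p hd (k + 1)
  have h3 : 0 ≤ Tn N ρ d (k + 1 + 1) := piMap_nonneg p _
  have hR := p.R_pos
  have hρ := p.h0
  have hq := p.quarter
  by_contra hcon
  have h4 : 2 ≤ d k ∨ (1 ≤ d k ∧ 1 ≤ d (k + 1)) := by omega
  have h5 : 0 ≤ Tn N ρ d (k + 1) := piMap_nonneg p _
  rcases h4 with h4 | ⟨h4, h6⟩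
  · have : (2:ℝ) ≤ d k := by exact_mod_cast h4
    nlinarith
  · have h4 : (1:ℝ) ≤ d k := by exact_mod_cast h4
    have h6 : (1:ℝ) ≤ d (k + 1) := by exact_mod_cast h6
    have h7 : R N ρ ≤ Tn N ρ d (k + 1) := by nlinarith
    nlinarith

lemma Tn_refl_lt (p : Par N ρ) {d : ℕ → ℕ} (hd : ∀ i, d i < N) {k : ℕ} {τ : ℝ}
    (hτ : τ ≤ R N ρ * (1 + ρ)) (h : 1 - Tn N ρ d k < τ) :
    d k = N - 1 ∨ (d k = N - 2 ∧ d (k + 1) = N - 1) := by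
  have hN := p.hN
  have e : Tn N ρ (fun i => N - 1 - d i) k = 1 - Tn N ρ d k :=
    piMap_refl p (fun i => hd _) (fun i => by have := hd (k + i); show N - 1 - d (k + i) + d (k + i) = N - 1; omega)
  rw [← e] at h
  have := Tn_lt p (d := fun i => N - 1 - d i) (fun i => by omega) hτ h
  have := hd k
  have := hd (k + 1)
  omega

lemma coding (p : Par N ρ) {d : ℕ → ℕ} (hd : ∀ i, d i < N) {τ : ℝ} (hτ : τ ≤ R N ρ * (1 + ρ))
    {k0 : ℕ} (hc : ∀ n, k0 ≤ n → (d n ≠ 0 ∧ Tn N ρ d (n + 1) < τ) ∨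
      (d n ≠ N - 1 ∧ 1 - Tn N ρ d (n + 1) < τ)) :
    ∃ x : ℕ → Bool, (∀ k, k0 ≤ k → d (k + 1) = dig N x (k + 1)) ∧
      ∀ k, k0 ≤ k → Lf N ρ (g ρ x (k + 1)) < τ := by
  classical
  have hN := p.hN
  set A : ℕ → Prop := fun k => d k ≠ 0 ∧ (d (k + 1) = 0 ∨ (d (k + 1) = 1 ∧ d (k + 1 + 1) = 0)) with hA
  set B : ℕ → Prop := fun k => d k ≠ N - 1 ∧
    (d (k + 1) = N - 1 ∨ (d (k + 1) = N - 2 ∧ d (k + 1 + 1) = N - 1)) with hB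
  have hcA : ∀ n, d n ≠ 0 ∧ Tn N ρ d (n + 1) < τ → A n := fun n h => ⟨h.1, Tn_lt p hd hτ h.2⟩
  have hcB : ∀ n, d n ≠ N - 1 ∧ 1 - Tn N ρ d (n + 1) < τ → B n :=
    fun n h => ⟨h.1, Tn_refl_lt p hd hτ h.2⟩
  have hAB : ∀ n, k0 ≤ n → A n ∨ B n := fun n hn => (hc n hn).imp (hcA n) (hcB n)
  have hex : ∀ n, A n → ¬ B n := by
    intro n h1 h2
    simp only [hA, hB] at h1 h2
    have := hd n
    omega
  let x : ℕ → Bool := fun i => decide (A (i - 1))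
  have hxA : ∀ k, A k → x (k + 1) = true := fun k h => by simpa [x] using h
  have hxB : ∀ k, ¬ A k → x (k + 1) = false := fun k h => by simpa [x] using h
  have hdx : ∀ k, k0 ≤ k → d (k + 1) = dig N x (k + 1) := by
    intro k hk
    have h1 := hAB k hk
    have h2 := hAB (k + 1) (by omega)
    have h3 := hex k
    have h4 := hex (k + 1)
    unfold dig
    by_cases a1 : A k <;> by_cases a2 : A (k + 1)
    · rw [hxA _ a1, hxA _ a2]
      simp only [hA] at a1 a2
      simp only [if_true]; omega
    · rw [hxA _ a1, hxB _ a2]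
      have b2 := h2.resolve_left a2
      simp only [hA, hB] at a1 a2 b2
      simp only [if_true, Bool.false_eq_true, if_false]; omega
    · rw [hxB _ a1, hxA _ a2]
      have b1 := h1.resolve_left a1
      simp only [hA, hB] at a1 a2 b1
      have := hd (k + 1)
      simp only [if_true, Bool.false_eq_true, if_false]; omega
    · rw [hxB _ a1, hxB _ a2]
      have b1 := h1.resolve_left a1
      have b2 := h2.resolve_left a2
      simp only [hA, hB] at a1 a2 b1 b2
      simp only [Bool.false_eq_true, if_false]; omega
  refine ⟨x, hdx, fun k hk => ?_⟩
  have e : Tn N ρ d (k + 1) = Tn N ρ (dig N x) (k + 1) := by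
    unfold Tn; congr 1; funext i
    have := hdx (k + i) (by omega)
    rw [show k + i + 1 = k + 1 + i by omega] at this
    exact this
  rcases hc k hk with h | h
  · rw [← Tn_true p (hxA k (hcA k h)), ← e]; exact h.2
  · rw [← Tn_false p (hxB k (fun h' => hex k h' (hcB k h))), ← e]; exact h.2

end

section
variable {N : ℕ} {ρ : ℝ} {μ : Measure ℝ}

/-- prepend `true` -/
def cons (c : ℕ → Bool) (i : ℕ) : Bool := Nat.casesOn i true c

lemma piMap_dig_val (p : Par N ρ) : ∃ C K : ℝ, 0 < K ∧ ∀ x : ℕ → Bool, x 0 = true →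
    piMap N ρ (dig N x) = C + K * val ρ x := by
  have h1 : ρ < 1 := by linarith [p.quarter]
  have hρ := p.h0
  have hR := p.R_pos
  have hk := kappa_pos p
  refine ⟨1 / 2 - R N ρ / 2 * ((1 - ((N:ℝ) - 2) * ρ) / ρ + ((N:ℝ) - 2)),
    R N ρ / 2 * ((1 - ((N:ℝ) - 2) * ρ) / ρ), by positivity, fun x hx => ?_⟩
  rw [piMap_dig p, val_succ hρ h1 x, hx, sgn_true]
  field_simp
  ring

lemma phi_tendsto (p : Par N ρ) {s τ : ℝ} (hτ : 0 ≤ τ) {u : ℕ → ℝ} (hu : Tendsto u atTop (𝓝 τ)) :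
    Tendsto (fun n => (2 * (R N ρ / ρ - 1 + u n)) ^ (-s)) atTop
      (𝓝 ((2 * (R N ρ / ρ - 1 + τ)) ^ (-s))) := by
  have hβ := beta_pos p hτ
  exact ((hu.const_add _).const_mul _).rpow_const (Or.inl (by positivity))

lemma Lf_WW (p : Par N ρ) {σ : ℝ} (hσ : |σ| = 1) :
    Tendsto (fun n => Lf N ρ (WW n σ ρ)) atTop (𝓝 (Lf N ρ (W ρ))) :=
  (Lf_continuous.tendsto _).comp (WW_tendsto σ hσ p.h0 p.quarter)

lemma Lf_g_nonneg (p : Par N ρ) (x : ℕ → Bool) (n : ℕ) : 0 ≤ Lf N ρ (g ρ x n) := by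
  cases hx : x n
  · rw [← Tn_false p hx]
    have : Tn N ρ (dig N x) n ≤ 1 := piMap_le_one p (fun i => dig_lt p.hN _ _)
    linarith
  · rw [← Tn_true p hx]
    exact piMap_nonneg p _

lemma dens_of_g (p : Par N ρ) [IsProbabilityMeasure μ] (hss : IsSelfSimilar N ρ μ) {s : ℝ}
    (hs0 : 0 < s) (hs1 : s ≤ 1 / 2) (hsN : ρ ^ s * N = 1) {x : ℕ → Bool} {n : ℕ}
    (h : ∃ k, ∀ m, k ≤ m → g ρ x m ≤ WW n 1 ρ) :
    (2 * (R N ρ / ρ - 1 + max 0 (Lf N ρ (WW n 1 ρ)))) ^ (-s) ≤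
      lowerDensity μ s (piMap N ρ (dig N x)) := by
  obtain ⟨k, hk⟩ := h
  refine dens_ge p hss hs0 hs1 hsN (dig_lt p.hN x) (le_max_left _ _) k fun m hm => ?_
  apply cond_of_g p
  exact ((Lf_strictMono p).monotone (hk (m + 1) (by omega))).trans (le_max_right _ _)

theorem main_aux (p : Par N ρ) {s : ℝ} (hs : s = -Real.log N / Real.log ρ)
    [IsProbabilityMeasure μ] (hss : IsSelfSimilar N ρ μ) (a : ℝ) :
    (a < (2 * (R N ρ / ρ - 1 + Lf N ρ (W ρ))) ^ (-s) →
        0 < dimH {x ∈ cantorE N ρ | a ≤ lowerDensity μ s x}) ∧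
    (a = (2 * (R N ρ / ρ - 1 + Lf N ρ (W ρ))) ^ (-s) →
        ¬ {x ∈ cantorE N ρ | a ≤ lowerDensity μ s x}.Countable) ∧
    ((2 * (R N ρ / ρ - 1 + Lf N ρ (W ρ))) ^ (-s) < a →
        {x ∈ cantorE N ρ | a ≤ lowerDensity μ s x}.Countable) := by
  obtain ⟨hs0, hs1, hsN⟩ := s_facts p hs
  obtain ⟨t0, t1, t2⟩ := tau_bounds p
  have hρ := p.h0
  have hq := p.quarter
  have hρ1 : ρ < 1 := by linarith
  obtain ⟨C, K, hK, hCK⟩ := piMap_dig_val p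
  have hmax : Tendsto (fun n => max 0 (Lf N ρ (WW n 1 ρ))) atTop (𝓝 (Lf N ρ (W ρ))) := by
    have := (tendsto_const_nhds (x := (0:ℝ))).max (Lf_WW p (σ := 1) (by simp))
    rwa [max_eq_right t0] at this
  refine ⟨fun ha => ?_, fun ha => ?_, fun ha => ?_⟩
  · obtain ⟨n, hn⟩ := ((phi_tendsto p t0 hmax).eventually (lt_mem_nhds ha)).exists
    obtain ⟨B, hB, hv⟩ := val_isub n hρ hq
    have hQ0 : 0 < ρ ^ (2 ^ n) := by positivity
    have hQ : ρ ^ (2 ^ n) ≤ 1 / 4 :=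
      (pow_le_of_le_one hρ.le hρ1.le (by positivity)).trans hq
    have h0 : ∀ c, isub n (cons c) 0 = true := fun c => by rw [isub_zero]; rfl
    refine dim_pos hQ0 hQ (K := K * B * ρ ^ (2 ^ n)) (by positivity)
      (fun c => piMap N ρ (dig N (isub n (cons c)))) _ (fun c => ⟨⟨_, dig_lt p.hN _, rfl⟩, ?_⟩) ?_
    · exact hn.le.trans (dens_of_g p hss hs0 hs1 hsN ⟨0, fun m _ => g_isub_le n hρ hq _ m⟩)
    · intro c c'
      have e : ∀ c, val (ρ ^ (2 ^ n)) (cons c) = 1 + ρ ^ (2 ^ n) * val (ρ ^ (2 ^ n)) c :=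
        fun c => val_succ hQ0 (by linarith) (cons c)
      rw [hCK _ (h0 c), hCK _ (h0 c'), hv, hv, e, e]
      rw [show C + K * (B * (1 + ρ ^ 2 ^ n * val (ρ ^ 2 ^ n) c)) -
        (C + K * (B * (1 + ρ ^ 2 ^ n * val (ρ ^ 2 ^ n) c'))) =
        (K * B * ρ ^ (2 ^ n)) * (val (ρ ^ 2 ^ n) c - val (ρ ^ 2 ^ n) c') by ring, abs_mul,
        abs_of_pos (by positivity : 0 < K * B * ρ ^ (2 ^ n))]
  · intro hcount
    have h0 : ∀ c, gen (cons c) 0 = true := fun c => by rw [gen_zero]; rfl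
    let P : (ℕ → Bool) → ℝ := fun c => piMap N ρ (dig N (gen (cons c)))
    have hP : ∀ c, P c ∈ {x ∈ cantorE N ρ | a ≤ lowerDensity μ s x} := by
      intro c
      refine ⟨⟨_, dig_lt p.hN _, rfl⟩, ?_⟩
      rw [ha]
      refine le_of_tendsto' (phi_tendsto p t0 hmax) fun n => ?_
      exact dens_of_g p hss hs0 hs1 hsN (g_gen_le n hρ hq (cons c))
    have hinj : Function.Injective P := by
      intro c c' h
      simp only [P] at h
      rw [hCK _ (h0 c), hCK _ (h0 c')] at h
      have h1 : val ρ (gen (cons c)) = val ρ (gen (cons c')) :=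
        mul_left_cancel₀ hK.ne' (add_left_cancel h)
      have h2 := val_inj hρ hq h1
      funext i
      exact gen_inj_aux (i + 1) _ _ h2
    have h1 : (univ : Set (ℕ → Bool)).Countable := by
      refine MapsTo.countable_of_injOn (f := P) (fun c _ => hP c) hinj.injOn hcount
    have h2 : Countable (ℕ → Bool) := countable_univ_iff.1 h1
    obtain ⟨F, hF⟩ := exists_surjective_nat (ℕ → Bool)
    obtain ⟨i, hi⟩ := hF (fun i => !F i i)
    have h3 := congrFun hi i
    simp at h3
  · have hmin : Tendsto (fun n => max 0 (min (Lf N ρ (W ρ)) (Lf N ρ (WW n (-1) ρ)))) atTop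
        (𝓝 (Lf N ρ (W ρ))) := by
      have := (tendsto_const_nhds (x := (0:ℝ))).max
        ((tendsto_const_nhds (x := Lf N ρ (W ρ))).min (Lf_WW p (σ := -1) (by simp)))
      rwa [min_self, max_eq_right t0] at this
    obtain ⟨n, hn⟩ := ((phi_tendsto p t0 hmin).eventually (gt_mem_nhds ha)).exists
    set τ := max 0 (min (Lf N ρ (W ρ)) (Lf N ρ (WW n (-1) ρ)))
    have hττ : τ ≤ Lf N ρ (W ρ) := max_le t0 (min_le_left _ _)
    have hτ0 : 0 ≤ τ := le_max_left _ _
    set X := {x : ℕ → Bool | ∃ k, ∀ m, k ≤ m → g ρ x m < WW n (-1) ρ}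
    have hX : X.Countable := countable_core n hρ hq
    have hD : (⋃ x ∈ X, ⋃ k : ℕ, {d : ℕ → ℕ | ∀ i, d (k + i) = dig N x (k + i)}).Countable :=
      hX.biUnion fun x _ => countable_iUnion fun k => countable_tail (fun i => dig N x (k + i)) k
    refine (hD.image (piMap N ρ)).mono ?_
    rintro y ⟨⟨d, hd, rfl⟩, hy⟩
    refine ⟨d, ?_, rfl⟩
    obtain ⟨k0, hk0⟩ := dens_le p hss hsN hd hτ0 (hττ.trans t1) hn hy
    obtain ⟨x, hx1, hx2⟩ := coding p hd (hττ.trans t2) hk0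
    simp only [mem_iUnion]
    refine ⟨x, ⟨k0 + 1, fun m hm => ?_⟩, k0 + 1, fun i => ?_⟩
    · obtain ⟨k, rfl⟩ : ∃ k, m = k + 1 := ⟨m - 1, by omega⟩
      have h1 := hx2 k (by omega)
      have h2 := Lf_g_nonneg p x (k + 1)
      rcases lt_max_iff.1 h1 with h | h
      · linarith
      · exact (Lf_strictMono p).lt_iff_lt.1 (h.trans_le (min_le_right _ _))
    · have := hx1 (k0 + i) (by omega)
      rw [show k0 + i + 1 = k0 + 1 + i by omega] at this
      exact this

end

/-- Theorem 2 (A): the critical value `a_c` for `E_*(a) = {x ∈ E : Θ_*^s(μ,x) ≥ a}`. -/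
theorem critical_value_lower (N : ℕ) (hN : 2 ≤ N) (ρ : ℝ) (hρ0 : 0 < ρ)
    (hρ1 : ρ ≤ 1 / (N : ℝ) ^ 2) (s : ℝ) (hs : s = -Real.log N / Real.log ρ)
    (μ : Measure ℝ) (hprob : IsProbabilityMeasure μ) (hss : IsSelfSimilar N ρ μ)
    (lam : ℕ → ℕ) (hlam1 : lam 1 = N - 1)
    (hlam2 : ∀ n j : ℕ, 1 ≤ j → j < 2 ^ n → lam (2 ^ n + j) = N - 1 - lam j)
    (hlam3 : ∀ n : ℕ, lam (2 ^ (n + 1)) = N - lam (2 ^ n))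
    (a : ℝ) :
    (a < (2 * (R N ρ / ρ - 1 + R N ρ * ∑' i : ℕ, (lam (i + 2) : ℝ) * ρ ^ i)) ^ (-s) →
        0 < dimH {x ∈ cantorE N ρ | a ≤ lowerDensity μ s x}) ∧
    (a = (2 * (R N ρ / ρ - 1 + R N ρ * ∑' i : ℕ, (lam (i + 2) : ℝ) * ρ ^ i)) ^ (-s) →
        ¬ {x ∈ cantorE N ρ | a ≤ lowerDensity μ s x}.Countable) ∧
    ((2 * (R N ρ / ρ - 1 + R N ρ * ∑' i : ℕ, (lam (i + 2) : ℝ) * ρ ^ i)) ^ (-s) < a →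
        {x ∈ cantorE N ρ | a ≤ lowerDensity μ s x}.Countable) := by
  have p : Par N ρ := ⟨hN, hρ0, by
    have h2 : (0:ℝ) < (N:ℝ) ^ 2 := by
      have : 0 < N := by omega
      positivity
    rwa [le_div_iff₀ h2] at hρ1⟩
  rw [tau_eq p hlam1 hlam2 hlam3]
  exact main_aux p hs hss a

end HomogeneousCantorDensity
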